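/- arXiv:1404.4471 — 3 statements merged into one kernel-verified Lean document; each statement's English description precedes it below -/
import Mathlib

section
/- Let n = 5, 7, 9, … (odd, n ≥ 5), p > 1, 0 ≤ ν < p, T > 0, and let L be the integral operator defined via the spherical mean. Assume U, U₀ ∈ C⁰(ℝⁿ × [0,T]) with supp U ⊂ {|x| ≤ t + k}, supp U₀ ⊂ {t − k ≤ |x| ≤ t + k}, and both ‖U‖ and N₀ := sup_{(x,t)} τ₊(|x|,t)^{(n−1)/2}|U₀(x,t)| are finite. Then there exists a constant C_{n,ν,p} > 0 (depending on n, ν, p, and in the case p = (n+1)/(n−1) also on the arbitrary constant δ > 0) such that ‖L(|U₀|^{p−ν}|U|^ν)‖ ≤ C_{n,ν,p} k² N₀^{p−ν} ‖U‖^ν E_ν(T), where E_ν(T) = 1 if p > (n+1)/(n−1); E_ν(T) = ((2T+3k)/k)^{νδ} if p = (n+1)/(n−1); E_ν(T) = ((2T+3k)/k)^{−νq} if p < (n+1)/(n−1). -/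
open MeasureTheory Real
open scoped Classical

noncomputable section

abbrev Rn (n : ℕ) := EuclideanSpace ℝ (Fin n)

/-- `ω_n = 2π^{n/2}/Γ(n/2)`, the measure of the unit sphere in `ℝⁿ`. -/
def omegaN (n : ℕ) : ℝ := 2 * Real.pi ^ ((n : ℝ) / 2) / Real.Gamma ((n : ℝ) / 2)

/-- The mean value operator `M(φ|x,r)`. -/
def Mop (n : ℕ) (φ : Rn n → ℝ) (x : Rn n) (r : ℝ) : ℝ :=
  if n % 2 = 1 then
    (1 / omegaN n) *
      ∫ ω in Metric.sphere (0 : Rn n) 1, φ (x + r • ω) ∂(Measure.hausdorffMeasure ((n : ℝ) - 1))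
  else
    (2 / omegaN (n + 1)) *
      ∫ ξ in Metric.ball (0 : Rn n) 1, φ (x + r • ξ) / Real.sqrt (1 - ‖ξ‖ ^ 2)

/-- The integral operator `L`. -/
def Lop (n : ℕ) (Ψ : Rn n → ℝ → ℝ) (x : Rn n) (t : ℝ) : ℝ :=
  (1 / (2 * ((n / 2 : ℕ) : ℝ) - 1)) * ∫ τ in (0:ℝ)..t, (t - τ) * Mop n (fun y => Ψ y τ) x (t - τ)

/-- Iterates of the operator `(1/t)∂/∂t`. -/
def DtIter : ℕ → (ℝ → ℝ) → (ℝ → ℝ)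
  | 0, F => F
  | j+1, F => fun t => (1 / t) * deriv (DtIter j F) t

/-- `R(φ|x,t) = (1/(2m−1)!!)((1/t)∂/∂t)^{m−1}{t^{2m−1} M(φ|x,t)}` where `m = n/2` resp. `(n-1)/2`. -/
def Rop (n : ℕ) (φ : Rn n → ℝ) (x : Rn n) (t : ℝ) : ℝ :=
  (1 / (Nat.doubleFactorial (2 * (n / 2) - 1) : ℝ)) *
    DtIter (n / 2 - 1) (fun s => s ^ (2 * (n / 2) - 1) * Mop n φ x s) t

def gammaPN (p : ℝ) (n : ℕ) : ℝ := 2 + ((n : ℝ) + 1) * p - ((n : ℝ) - 1) * p ^ 2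

/-- The Strauss exponent `p₀(n)`. -/
def pCrit (n : ℕ) : ℝ :=
  ((n : ℝ) + 1 + Real.sqrt ((n : ℝ) ^ 2 + 10 * (n : ℝ) - 7)) / (2 * ((n : ℝ) - 1))

def tauP (k r t : ℝ) : ℝ := (t + r + 2 * k) / k
def tauM (k r t : ℝ) : ℝ := (t - r + 2 * k) / k

def qExp (n : ℕ) (p : ℝ) : ℝ := ((n : ℝ) - 1) / 2 * p - ((n : ℝ) + 1) / 2

/-- The weight function `w(r,t)`. -/
def wWt (n : ℕ) (k p : ℝ) (r t : ℝ) : ℝ :=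
  if ((n : ℝ) + 1) / ((n : ℝ) - 1) < p then
    tauP k r t ^ (((n : ℝ) - 1) / 2) * tauM k r t ^ qExp n p
  else if p = ((n : ℝ) + 1) / ((n : ℝ) - 1) then
    tauP k r t ^ (((n : ℝ) - 1) / 2) * (Real.log (4 * tauP k r t / tauM k r t))⁻¹
  else
    tauP k r t ^ (((n : ℝ) - 1) / 2 + qExp n p)

/-- The weighted `L^∞` norm `‖U‖` on `ℝⁿ × [0,T]`. -/
def wNorm (n : ℕ) (k p T : ℝ) (U : Rn n → ℝ → ℝ) : ℝ :=
  sSup ((fun pr : Rn n × ℝ => wWt n k p ‖pr.1‖ pr.2 * |U pr.1 pr.2|) ''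
    (Set.univ ×ˢ Set.Icc 0 T))


/-- `E_ν(T)` of Lemma 4.2 (for `0 ≤ ν < p`). -/
def EnuOdd (n : ℕ) (p ν δ k T : ℝ) : ℝ :=
  if ((n : ℝ) + 1) / ((n : ℝ) - 1) < p then 1
  else if p = ((n : ℝ) + 1) / ((n : ℝ) - 1) then ((2 * T + 3 * k) / k) ^ (ν * δ)
  else ((2 * T + 3 * k) / k) ^ (-(ν * qExp n p))

/-- `N₀ = sup τ₊^{(n−1)/2}|U₀|` over `ℝⁿ × [0,T]`. -/
def NzeroOdd (n : ℕ) (k T : ℝ) (U₀ : Rn n → ℝ → ℝ) : ℝ :=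
  sSup ((fun pr : Rn n × ℝ => tauP k ‖pr.1‖ pr.2 ^ (((n : ℝ) - 1) / 2) * |U₀ pr.1 pr.2|) ''
    (Set.univ ×ˢ Set.Icc 0 T))


lemma hm_le_of_antilip {X Y : Type*} [EMetricSpace X] [EMetricSpace Y] [MeasurableSpace X]
    [BorelSpace X] [MeasurableSpace Y] [BorelSpace Y] (K : NNReal) (f : X → Y) (s : Set X)
    (h : ∀ x ∈ s, ∀ y ∈ s, edist x y ≤ K * edist (f x) (f y)) (d : ℝ) (hd : 0 ≤ d) :
    Measure.hausdorffMeasure d s ≤ (K : ENNReal) ^ d * Measure.hausdorffMeasure d (f '' s) := by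
  rcases s.eq_empty_or_nonempty with hs | ⟨x0, hx0⟩
  · subst hs; simp
  have : Nonempty X := ⟨x0⟩
  have hg : ∀ x ∈ s, Function.invFunOn f s (f x) = x := by
    intro x hx
    have hm : ∃ a ∈ s, f a = f x := ⟨x, hx, rfl⟩
    have h1 := Function.invFunOn_mem hm
    have h2 := Function.invFunOn_eq hm
    have h3 := h _ h1 _ hx
    rw [h2, edist_self, mul_zero] at h3
    exact edist_le_zero.1 h3
  have hL : LipschitzOnWith K (Function.invFunOn f s) (f '' s) := by
    rintro _ ⟨x, hx, rfl⟩ _ ⟨y, hy, rfl⟩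
    rw [hg x hx, hg y hy]
    exact h x hx y hy
  have h4 := hL.hausdorffMeasure_image_le hd
  rw [Set.image_image] at h4
  rw [Set.image_congr hg, Set.image_id'] at h4
  exact h4

lemma cap_le (m : ℕ) (i : Fin (2 * m + 1)) (ε : ℝ) (hε : |ε| = 1)
    (B : Set (Rn (2 * m + 1)))
    (hB : ∀ ω ∈ B, ‖ω‖ = 1 ∧ 1 ≤ ((2 * m + 1 : ℕ) : ℝ) * (ε * ω i)) :
    Measure.hausdorffMeasure (((2 * m + 1 : ℕ) : ℝ) - 1) B ≤
      ENNReal.ofReal ((2 * ((2 * m + 1 : ℕ) : ℝ) ^ 3) ^ (2 * m)) *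
        volume ((fun (ω : Rn (2 * m + 1)) (j : Fin (2 * m)) => ω (i.succAbove j)) '' B) := by
  set N : ℝ := ((2 * m + 1 : ℕ) : ℝ) with hN
  have hN1 : 1 ≤ N := by rw [hN]; exact_mod_cast Nat.le_add_left 1 _
  have hd : N - 1 = ((Fintype.card (Fin (2 * m)) : ℕ) : ℝ) := by
    rw [hN]; push_cast; simp
  set f := (fun (ω : Rn (2 * m + 1)) (j : Fin (2 * m)) => ω (i.succAbove j)) with hf
  have key := hm_le_of_antilip (Real.toNNReal (2 * N ^ 3)) f B ?_ (N - 1) (by linarith)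
  · rw [hd, hausdorffMeasure_pi_real] at key
    rw [hd]
    refine key.trans (le_of_eq ?_)
    congr 1
    rw [ENNReal.rpow_natCast, Fintype.card_fin, ENNReal.ofReal_pow (by positivity)]
    rfl
  · intro x hx y hy
    obtain ⟨hx1, hx2⟩ := hB x hx
    obtain ⟨hy1, hy2⟩ := hB y hy
    rw [edist_dist, edist_dist, ← ENNReal.ofReal_coe_nnreal, Real.coe_toNNReal _ (by positivity),
      ← ENNReal.ofReal_mul (by positivity)]
    apply ENNReal.ofReal_le_ofReal
    set d := dist (f x) (f y) with hdd
    have hd0 : 0 ≤ d := dist_nonneg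
    have hj : ∀ j, |x (i.succAbove j) - y (i.succAbove j)| ≤ d := by
      intro j
      have := dist_le_pi_dist (f x) (f y) j
      rwa [Real.dist_eq] at this
    have hx3 : ∀ j, |x j| ≤ 1 := fun j => by
      have := PiLp.norm_apply_le x j
      rwa [hx1, Real.norm_eq_abs] at this
    have hy3 : ∀ j, |y j| ≤ 1 := fun j => by
      have := PiLp.norm_apply_le y j
      rwa [hy1, Real.norm_eq_abs] at this
    have hxs : ∑ j, x j ^ 2 = 1 := by
      have := EuclideanSpace.real_norm_sq_eq x
      rw [← this, hx1]; norm_num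
    have hys : ∑ j, y j ^ 2 = 1 := by
      have := EuclideanSpace.real_norm_sq_eq y
      rw [← this, hy1]; norm_num
    rw [Fin.sum_univ_succAbove _ i] at hxs hys
    have hdiff : |x i ^ 2 - y i ^ 2| ≤ 2 * N * d := by
      have e : x i ^ 2 - y i ^ 2 =
          ∑ j, (y (i.succAbove j) ^ 2 - x (i.succAbove j) ^ 2) := by
        rw [Finset.sum_sub_distrib]; linarith
      rw [e]
      refine (Finset.abs_sum_le_sum_abs _ _).trans ?_
      have : ∀ j ∈ (Finset.univ : Finset (Fin (2 * m))),
          |y (i.succAbove j) ^ 2 - x (i.succAbove j) ^ 2| ≤ 2 * d := by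
        intro j _
        have e2 : y (i.succAbove j) ^ 2 - x (i.succAbove j) ^ 2 =
          -((y (i.succAbove j) + x (i.succAbove j)) * (x (i.succAbove j) - y (i.succAbove j))) := by
          ring
        rw [e2, abs_neg, abs_mul]
        refine mul_le_mul ?_ (hj j) (abs_nonneg _) (by norm_num)
        refine (abs_add_le _ _).trans ?_
        linarith [hx3 (i.succAbove j), hy3 (i.succAbove j)]
      refine (Finset.sum_le_card_nsmul _ _ _ this).trans ?_
      simp only [Finset.card_univ, Fintype.card_fin, nsmul_eq_mul]
      have : ((2 * m : ℕ) : ℝ) ≤ N := by rw [hN]; exact_mod_cast Nat.le_succ _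
      nlinarith
    have hi : |x i - y i| ≤ 2 * N ^ 2 * d := by
      have e : x i ^ 2 - y i ^ 2 = (x i - y i) * (x i + y i) := by ring
      rw [e, abs_mul] at hdiff
      have h1 : 1 ≤ N * |x i + y i| := by
        have : ε * x i + ε * y i ≤ |x i + y i| := by
          calc ε * x i + ε * y i = ε * (x i + y i) := by ring
            _ ≤ |ε * (x i + y i)| := le_abs_self _
            _ = |x i + y i| := by rw [abs_mul, hε, one_mul]
        nlinarith
      calc |x i - y i| = |x i - y i| * 1 := by ring
        _ ≤ |x i - y i| * (N * |x i + y i|) := by gcongr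
        _ = N * (|x i - y i| * |x i + y i|) := by ring
        _ ≤ N * (2 * N * d) := by gcongr
        _ = _ := by ring
    have hall : ∀ j, |x j - y j| ≤ 2 * N ^ 2 * d := by
      intro j
      rcases Fin.eq_self_or_eq_succAbove i j with h | ⟨j', h⟩
      · rw [h]; exact hi
      · rw [h]; refine (hj j').trans ?_
        nlinarith [mul_nonneg hd0 (by nlinarith : (0:ℝ) ≤ 2 * N ^ 2 - 1)]
    rw [EuclideanSpace.dist_eq]
    apply Real.sqrt_le_iff.2
    refine ⟨by positivity, ?_⟩
    have : ∀ j ∈ (Finset.univ : Finset (Fin (2 * m + 1))),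
        dist (x j) (y j) ^ 2 ≤ (2 * N ^ 2 * d) ^ 2 := by
      intro j _
      rw [Real.dist_eq]
      exact pow_le_pow_left₀ (abs_nonneg _) (hall j) 2
    refine (Finset.sum_le_card_nsmul _ _ _ this).trans ?_
    simp only [Finset.card_univ, Fintype.card_fin, nsmul_eq_mul]
    rw [← hN]
    have : (2 * N ^ 3 * d) ^ 2 = N ^ 2 * (2 * N ^ 2 * d) ^ 2 := by ring
    rw [this]
    gcongr
    nlinarith

lemma annulus_le (m : ℕ) (hm : 2 ≤ m) : ∃ C : ℝ, 0 < C ∧ ∀ c ℓ σ : ℝ, 0 ≤ ℓ → 0 ≤ σ →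
    volume {v : Fin (2 * m) → ℝ | c ≤ ∑ j, v j ^ 2 ∧ ∑ j, v j ^ 2 ≤ c + ℓ ∧ ∑ j, v j ^ 2 ≤ σ} ≤
      ENNReal.ofReal (C * ℓ * σ ^ (m - 1)) := by
  set κ := (volume (Metric.ball (0 : EuclideanSpace ℝ (Fin (2 * m))) 1)).toReal with hκ
  have hκ0 : 0 ≤ κ := ENNReal.toReal_nonneg
  have hfin : volume (Metric.ball (0 : EuclideanSpace ℝ (Fin (2 * m))) 1) = ENNReal.ofReal κ := by
    rw [hκ, ENNReal.ofReal_toReal measure_ball_lt_top.ne]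
  refine ⟨κ * m + 1, by positivity, ?_⟩
  intro c ℓ σ hℓ hσ
  have : Nontrivial (EuclideanSpace ℝ (Fin (2 * m))) := by
    have : Nonempty (Fin (2 * m)) := ⟨⟨0, by omega⟩⟩
    infer_instance
  set c1 := max c 0 with hc1
  set c2 := min (c + ℓ) σ with hc2
  set A : Set (Fin (2 * m) → ℝ) :=
    {v | c ≤ ∑ j, v j ^ 2 ∧ ∑ j, v j ^ 2 ≤ c + ℓ ∧ ∑ j, v j ^ 2 ≤ σ} with hA
  rcases A.eq_empty_or_nonempty with he | ⟨v0, hv0⟩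
  · rw [he]; simp
  have h0 : 0 ≤ ∑ j, v0 j ^ 2 := Finset.sum_nonneg fun j _ => sq_nonneg _
  have hc10 : 0 ≤ c1 := le_max_right _ _
  have hc12 : c1 ≤ c2 := by
    rw [hc1, hc2]; obtain ⟨a1, a2, a3⟩ := hv0
    exact max_le (le_min (by linarith) (by linarith)) (le_min (by linarith) hσ)
  have hc20 : 0 ≤ c2 := hc10.trans hc12
  have hc2σ : c2 ≤ σ := min_le_right _ _
  have hcd : c2 - c1 ≤ ℓ := by
    have : c2 ≤ c + ℓ := min_le_left _ _
    have : c ≤ c1 := le_max_left _ _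
    linarith
  have hpre : A ⊆ (WithLp.toLp 2) ⁻¹' (Metric.closedBall (0 : EuclideanSpace ℝ (Fin (2 * m))) (√c2) \
      Metric.ball 0 (√c1)) := by
    intro v hv
    obtain ⟨a1, a2, a3⟩ := hv
    have hn : ‖(WithLp.toLp 2 v : EuclideanSpace ℝ (Fin (2 * m)))‖ = √(∑ j, v j ^ 2) := by
      rw [EuclideanSpace.norm_eq]; simp
    simp only [Set.mem_preimage, Set.mem_sdiff, mem_closedBall_zero_iff, mem_ball_zero_iff, not_lt, hn]
    have h0 : 0 ≤ ∑ j, v j ^ 2 := Finset.sum_nonneg fun j _ => sq_nonneg _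
    exact ⟨Real.sqrt_le_sqrt (le_min a2 a3), Real.sqrt_le_sqrt (max_le a1 h0)⟩
  refine (measure_mono hpre).trans ?_
  rw [(PiLp.volume_preserving_toLp (Fin (2 * m))).measure_preimage
    ((measurableSet_closedBall.diff measurableSet_ball).nullMeasurableSet)]
  rw [measure_sdiff (Metric.ball_subset_closedBall.trans
    (Metric.closedBall_subset_closedBall (Real.sqrt_le_sqrt hc12)))
    measurableSet_ball.nullMeasurableSet measure_ball_lt_top.ne]
  rw [Measure.addHaar_closedBall _ _ (Real.sqrt_nonneg _), Measure.addHaar_ball _ _ (Real.sqrt_nonneg _),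
    hfin, finrank_euclideanSpace_fin, ← ENNReal.ofReal_mul (by positivity),
    ← ENNReal.ofReal_mul (by positivity), ← ENNReal.ofReal_sub _ (by positivity)]
  apply ENNReal.ofReal_le_ofReal
  rw [pow_mul, pow_mul, Real.sq_sqrt hc10, Real.sq_sqrt hc20]
  have hp : c2 ^ m - c1 ^ m ≤ m * c2 ^ (m - 1) * (c2 - c1) := by
    rcases hc12.eq_or_lt with h | h
    · rw [h]; simp
    have := (Commute.all c2 c1).mul_geom_sum₂ m
    rw [← this, mul_comm]
    refine mul_le_mul_of_nonneg_right ?_ (by linarith)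
    have h2 : ∀ i ∈ Finset.range m, c2 ^ i * c1 ^ (m - 1 - i) ≤ c2 ^ (m - 1) := by
      intro i hi
      have : i < m := Finset.mem_range.1 hi
      calc c2 ^ i * c1 ^ (m - 1 - i) ≤ c2 ^ i * c2 ^ (m - 1 - i) := by gcongr
        _ = c2 ^ (m - 1) := by rw [← pow_add]; congr 1; omega
    refine (Finset.sum_le_card_nsmul _ _ _ h2).trans ?_
    simp
  calc c2 ^ m * κ - c1 ^ m * κ = κ * (c2 ^ m - c1 ^ m) := by ring
    _ ≤ κ * (m * c2 ^ (m - 1) * (c2 - c1)) := by gcongr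
    _ ≤ κ * (m * σ ^ (m - 1) * ℓ) := by gcongr
    _ = (κ * m) * ℓ * σ ^ (m - 1) := by ring
    _ ≤ _ := by gcongr; linarith

lemma slab0 (m : ℕ) (hm : 2 ≤ m) : ∃ C : ℝ, 0 < C ∧ ∀ c ℓ σ : ℝ, 0 ≤ ℓ → 0 < σ → σ ≤ 1 →
    Measure.hausdorffMeasure (((2 * m + 1 : ℕ) : ℝ) - 1)
      {ω : Rn (2 * m + 1) | ‖ω‖ = 1 ∧ c ≤ ω 0 ∧ ω 0 ≤ c + ℓ ∧ 1 - ω 0 ^ 2 ≤ σ} ≤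
      ENNReal.ofReal (C * ℓ * σ ^ (m - 1)) := by
  obtain ⟨C1, hC1, hann⟩ := annulus_le m hm
  set N : ℝ := ((2 * m + 1 : ℕ) : ℝ) with hN
  have hN1 : 1 ≤ N := by rw [hN]; exact_mod_cast Nat.le_add_left 1 _
  set L : ℝ := (2 * N ^ 3) ^ (2 * m) with hL
  have hL0 : 0 < L := by positivity
  set K : ℝ := L * (C1 * 2 + 2 ^ (2 * m) * (N ^ 2) ^ (m - 1)) with hK
  have hK0 : 0 < K := by positivity
  refine ⟨N * (2 * K), by positivity, ?_⟩
  intro c ℓ σ hℓ hσ hσ1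
  set B : Set (Rn (2 * m + 1)) :=
    {ω | ‖ω‖ = 1 ∧ c ≤ ω 0 ∧ ω 0 ≤ c + ℓ ∧ 1 - ω 0 ^ 2 ≤ σ} with hB
  have hsum : ∀ ω ∈ B, ∀ i : Fin (2 * m + 1), ω i ^ 2 + ∑ j, ω (i.succAbove j) ^ 2 = 1 := by
    intro ω hω i
    have h1 := EuclideanSpace.real_norm_sq_eq ω
    rw [hω.1, Fin.sum_univ_succAbove _ i] at h1
    linarith
  have habs : ∀ ω ∈ B, ∀ j, |ω j| ≤ 1 := fun ω hω j => by
    have := PiLp.norm_apply_le ω j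
    rwa [hω.1, Real.norm_eq_abs] at this
  have hcap : ∀ (i : Fin (2 * m + 1)) (ε : ℝ), ε = 1 ∨ ε = -1 →
      Measure.hausdorffMeasure (N - 1) (B ∩ {ω | 1 ≤ N * (ε * ω i)}) ≤
        ENNReal.ofReal (K * ℓ * σ ^ (m - 1)) := by
    intro i ε hε
    have h1 := cap_le m i ε (by rcases hε with h | h <;> simp [h])
      (B ∩ {ω | 1 ≤ N * (ε * ω i)}) (fun ω hω => ⟨hω.1.1, hω.2⟩)
    refine h1.trans ?_
    rw [← hN, ← hL]
    have hgoal : ∀ V : ENNReal, V ≤ ENNReal.ofReal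
        ((C1 * 2 + 2 ^ (2 * m) * (N ^ 2) ^ (m - 1)) * ℓ * σ ^ (m - 1)) →
        ENNReal.ofReal L * V ≤ ENNReal.ofReal (K * ℓ * σ ^ (m - 1)) := by
      intro V hV
      refine (mul_le_mul_right hV _).trans ?_
      rw [← ENNReal.ofReal_mul hL0.le]
      apply ENNReal.ofReal_le_ofReal
      rw [hK]; apply le_of_eq; ring
    apply hgoal
    by_cases hi : i = 0
    · subst hi
      -- polar cap
      obtain ⟨c', hc'⟩ : ∃ c' : ℝ, ∀ ω ∈ B ∩ {ω | 1 ≤ N * (ε * ω 0)},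
          c' ≤ 1 - ω 0 ^ 2 ∧ 1 - ω 0 ^ 2 ≤ c' + 2 * ℓ := by
        rcases hε with h | h
        · subst h
          refine ⟨1 - (min (c + ℓ) 1) ^ 2, ?_⟩
          rintro ω ⟨hω, hω2⟩
          have ha := abs_le.1 (habs ω hω 0)
          obtain ⟨_, b1, b2, _⟩ := hω
          have hpos : 0 ≤ ω 0 := by
            simp only [Set.mem_ofPred_eq] at hω2
            by_contra hneg
            push Not at hneg
            nlinarith
          have e1 : ω 0 ≤ min (c + ℓ) 1 := le_min b2 ha.2
          have e2 : min (c + ℓ) 1 ≤ c + ℓ := min_le_left _ _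
          have e3 : min (c + ℓ) 1 ≤ 1 := min_le_right _ _
          generalize min (c + ℓ) 1 = b at *
          constructor <;> nlinarith
        · subst h
          refine ⟨1 - (max c (-1)) ^ 2, ?_⟩
          rintro ω ⟨hω, hω2⟩
          have ha := abs_le.1 (habs ω hω 0)
          obtain ⟨_, b1, b2, _⟩ := hω
          have hpos : ω 0 ≤ 0 := by
            simp only [Set.mem_ofPred_eq] at hω2
            by_contra hneg
            push Not at hneg
            nlinarith
          have e1 : max c (-1) ≤ ω 0 := max_le b1 ha.1
          have e2 : c ≤ max c (-1) := le_max_left _ _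
          have e3 : -1 ≤ max c (-1) := le_max_right _ _
          generalize max c (-1) = b at *
          constructor <;> nlinarith
      refine (measure_mono ?_).trans ((hann c' (2 * ℓ) σ (by linarith) hσ.le).trans ?_)
      · rintro _ ⟨ω, hω, rfl⟩
        have h3 := hsum ω hω.1 0
        have h4 := hc' ω hω
        have h5 := hω.1.2.2.2
        simp only [Set.mem_ofPred_eq]
        refine ⟨by linarith, by linarith, by linarith⟩
      · apply ENNReal.ofReal_le_ofReal
        have : 0 ≤ 2 ^ (2 * m) * (N ^ 2) ^ (m - 1) * ℓ * σ ^ (m - 1) := by positivity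
        nlinarith
    · rcases (B ∩ {ω | 1 ≤ N * (ε * ω i)}).eq_empty_or_nonempty with he | ⟨ω0, hω0⟩
      · rw [he]; simp
      obtain ⟨j0, hj0⟩ := Fin.exists_succAbove_eq (Ne.symm hi)
      have hσN : 1 ≤ N ^ 2 * σ := by
        have h3 := hsum ω0 hω0.1 i
        have h5 := hω0.1.2.2.2
        have h6 : ω0 0 ^ 2 ≤ ∑ j, ω0 (i.succAbove j) ^ 2 := by
          have := Finset.single_le_sum (f := fun j => ω0 (i.succAbove j) ^ 2)
            (fun j _ => sq_nonneg _) (Finset.mem_univ j0)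
          simpa [hj0] using this
        have h6' : ω0 i ^ 2 ≤ σ := by
          have : ω0 0 ^ 2 + ω0 i ^ 2 ≤ 1 := by linarith
          linarith
        have h7 : 1 ≤ N * (ε * ω0 i) := hω0.2
        have h8 : ε ^ 2 = 1 := by rcases hε with h | h <;> simp [h]
        calc (1:ℝ) ≤ (N * (ε * ω0 i)) ^ 2 := by nlinarith
          _ = N ^ 2 * (ε ^ 2 * ω0 i ^ 2) := by ring
          _ = N ^ 2 * ω0 i ^ 2 := by rw [h8, one_mul]
          _ ≤ N ^ 2 * σ := by gcongr
      have hsub : (fun (ω : Rn (2 * m + 1)) (j : Fin (2 * m)) => ω (i.succAbove j)) ''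
          (B ∩ {ω | 1 ≤ N * (ε * ω i)}) ⊆
          Set.pi Set.univ (fun j => if j = j0 then Set.Icc c (c + ℓ) else Set.Icc (-1:ℝ) 1) := by
        rintro _ ⟨ω, hω, rfl⟩
        intro j _
        by_cases hj : j = j0
        · subst hj
          simp only [if_true, hj0]
          exact ⟨hω.1.2.1, hω.1.2.2.1⟩
        · simp only [if_neg hj]
          exact abs_le.1 (habs ω hω.1 _)
      refine (measure_mono hsub).trans ?_
      rw [volume_pi_pi]
      have hprod : ∏ j, volume (if j = j0 then Set.Icc c (c + ℓ) else Set.Icc (-1:ℝ) 1) ≤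
          ENNReal.ofReal (ℓ * 2 ^ (2 * m)) := by
        rw [← Finset.mul_prod_erase _ _ (Finset.mem_univ j0)]
        simp only [if_true, Real.volume_Icc]
        rw [ENNReal.ofReal_mul hℓ]
        refine mul_le_mul' (by simp) ?_
        have : ∀ j ∈ (Finset.univ.erase j0),
            volume (if j = j0 then Set.Icc c (c + ℓ) else Set.Icc (-1:ℝ) 1) = ENNReal.ofReal 2 := by
          intro j hj
          rw [if_neg (Finset.ne_of_mem_erase hj), Real.volume_Icc]; norm_num
        rw [Finset.prod_congr rfl this, Finset.prod_const, ← ENNReal.ofReal_pow (by norm_num)]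
        apply ENNReal.ofReal_le_ofReal
        apply pow_le_pow_right₀ (by norm_num)
        simp
      refine hprod.trans (ENNReal.ofReal_le_ofReal ?_)
      have h9 : 1 ≤ (N ^ 2) ^ (m - 1) * σ ^ (m - 1) := by
        rw [← mul_pow]; exact one_le_pow₀ hσN
      calc ℓ * 2 ^ (2 * m) ≤ ℓ * 2 ^ (2 * m) * ((N ^ 2) ^ (m - 1) * σ ^ (m - 1)) :=
            le_mul_of_one_le_right (by positivity) h9
        _ ≤ C1 * 2 * ℓ * σ ^ (m - 1) + ℓ * 2 ^ (2 * m) * ((N ^ 2) ^ (m - 1) * σ ^ (m - 1)) :=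
            le_add_of_nonneg_left (by positivity)
        _ = _ := by ring
  have hcover : B ⊆ ⋃ i : Fin (2 * m + 1),
      ((B ∩ {ω | 1 ≤ N * (1 * ω i)}) ∪ (B ∩ {ω | 1 ≤ N * (-1 * ω i)})) := by
    intro ω hω
    have h1 : ∃ i : Fin (2 * m + 1), 1 ≤ N * ω i ^ 2 := by
      by_contra hcon
      push Not at hcon
      have h2 := EuclideanSpace.real_norm_sq_eq ω
      rw [hω.1] at h2
      have h3 : ∑ i, N * ω i ^ 2 < ∑ i : Fin (2 * m + 1), (1:ℝ) :=
        Finset.sum_lt_sum_of_nonempty ⟨0, Finset.mem_univ _⟩ (fun i _ => hcon i)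
      rw [← Finset.mul_sum, ← h2] at h3
      simp only [Finset.sum_const, Finset.card_univ, Fintype.card_fin, nsmul_eq_mul] at h3
      rw [← hN] at h3
      linarith
    obtain ⟨i, hi⟩ := h1
    have h2 : 1 ≤ N * |ω i| := by
      have h3 := habs ω hω i
      rw [← sq_abs] at hi
      have : |ω i| ^ 2 ≤ |ω i| := by nlinarith [abs_nonneg (ω i)]
      nlinarith
    refine Set.mem_iUnion.2 ⟨i, ?_⟩
    rcases abs_choice (ω i) with h | h
    · left; refine ⟨hω, ?_⟩; simp only [Set.mem_ofPred_eq]; rw [h] at h2; linarith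
    · right; refine ⟨hω, ?_⟩; simp only [Set.mem_ofPred_eq]; rw [h] at h2; linarith
  refine (measure_mono hcover).trans ((measure_iUnion_fintype_le _ _).trans ?_)
  have hQ : 0 ≤ K * ℓ * σ ^ (m - 1) := by positivity
  have hone : ∀ i ∈ (Finset.univ : Finset (Fin (2 * m + 1))),
      Measure.hausdorffMeasure (N - 1)
        ((B ∩ {ω : Rn (2 * m + 1) | 1 ≤ N * (1 * ω i)}) ∪ (B ∩ {ω | 1 ≤ N * (-1 * ω i)})) ≤
      ENNReal.ofReal (2 * (K * ℓ * σ ^ (m - 1))) := by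
    intro i _
    refine (measure_union_le _ _).trans ?_
    rw [two_mul (K * ℓ * σ ^ (m - 1)), ENNReal.ofReal_add hQ hQ]
    exact add_le_add (hcap i 1 (Or.inl rfl)) (hcap i (-1) (Or.inr rfl))
  refine (Finset.sum_le_card_nsmul _ _ _ hone).trans ?_
  rw [Finset.card_univ, Fintype.card_fin, nsmul_eq_mul, ← ENNReal.ofReal_natCast,
    ← ENNReal.ofReal_mul (by positivity)]
  apply ENNReal.ofReal_le_ofReal
  rw [← hN]
  apply le_of_eq; ring

lemma slab (m : ℕ) (hm : 2 ≤ m) : ∃ C : ℝ, 0 < C ∧ ∀ e : Rn (2 * m + 1), ‖e‖ = 1 →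
    ∀ c ℓ σ : ℝ, 0 ≤ ℓ → 0 < σ → σ ≤ 1 →
    Measure.hausdorffMeasure (((2 * m + 1 : ℕ) : ℝ) - 1)
      {ω : Rn (2 * m + 1) | ‖ω‖ = 1 ∧ c ≤ inner ℝ e ω ∧ inner ℝ e ω ≤ c + ℓ ∧
        1 - (inner ℝ e ω) ^ 2 ≤ σ} ≤
      ENNReal.ofReal (C * ℓ * σ ^ (m - 1)) := by
  obtain ⟨C, hC, h⟩ := slab0 m hm
  refine ⟨C, hC, ?_⟩
  intro e he c ℓ σ hℓ hσ hσ1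
  have hon : Orthonormal ℝ (({0} : Set (Fin (2 * m + 1))).domRestrict (fun _ => e)) := by
    constructor
    · intro i; exact he
    · intro i j hij; exact absurd (Subsingleton.elim i j) hij
  obtain ⟨b, hb⟩ := hon.exists_orthonormalBasis_extension_of_card_eq
    (by simp) 
  have hb0 : b 0 = e := hb 0 rfl
  have h1 := h c ℓ σ hℓ hσ hσ1
  rw [← b.repr.toIsometryEquiv.hausdorffMeasure_preimage] at h1
  refine le_trans (le_of_eq ?_) h1
  congr 1
  ext ω
  simp only [Set.mem_preimage, Set.mem_ofPred_eq, LinearIsometryEquiv.coe_toIsometryEquiv,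
    LinearIsometryEquiv.norm_map, OrthonormalBasis.repr_apply_apply, hb0]

/-- The spherical slice measure. -/
def DD (n : ℕ) (k : ℝ) (x : Rn n) (t τ : ℝ) : ENNReal :=
  Measure.hausdorffMeasure ((n : ℝ) - 1)
    {ω : Rn n | ‖ω‖ = 1 ∧ τ - k ≤ ‖x + (t - τ) • ω‖ ∧ ‖x + (t - τ) • ω‖ ≤ τ + k}

lemma sphere_fin (m : ℕ) (hm : 2 ≤ m) : ∃ C : ℝ, 0 < C ∧
    Measure.hausdorffMeasure (((2 * m + 1 : ℕ) : ℝ) - 1) {ω : Rn (2 * m + 1) | ‖ω‖ = 1} ≤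
      ENNReal.ofReal C := by
  obtain ⟨C, hC, h⟩ := slab0 m hm
  refine ⟨C * 2, by positivity, ?_⟩
  have := h (-1) 2 1 (by norm_num) (by norm_num) le_rfl
  simp only [one_pow, mul_one] at this
  refine le_trans (measure_mono ?_) this
  intro ω hω
  have h1 := PiLp.norm_apply_le ω 0
  have hω' : ‖ω‖ = 1 := hω
  rw [hω', Real.norm_eq_abs] at h1
  have h2 := abs_le.1 h1
  exact ⟨hω, h2.1, by linarith, by nlinarith⟩

lemma slice (m : ℕ) (hm : 2 ≤ m) : ∃ C : ℝ, 0 < C ∧ ∀ (k t τ : ℝ) (x : Rn (2 * m + 1)),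
    0 < k → 0 ≤ τ → τ < t → x ≠ 0 →
    (DD (2 * m + 1) k x t τ).toReal ≤ C * (k * (τ + k) / (‖x‖ * (t - τ))) ∧
    (DD (2 * m + 1) k x t τ).toReal ≤ C * (k * (τ + k) / (‖x‖ * (t - τ))) *
      ((τ + k) / ‖x‖) ^ (m - 1) := by
  obtain ⟨C, hC, h⟩ := slab m hm
  refine ⟨C * 2, by positivity, ?_⟩
  intro k t τ x hk hτ hτt hx
  set r := ‖x‖ with hr
  have hr0 : 0 < r := norm_pos_iff.2 hx
  set s := t - τ with hs
  have hs0 : 0 < s := by linarith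
  have gen : ∀ σ : ℝ, 0 < σ → σ ≤ 1 → (σ = 1 ∨ (τ + k) / r ≤ σ) →
      (DD (2 * m + 1) k x t τ).toReal ≤ C * 2 * (k * (τ + k) / (r * s)) * σ ^ (m - 1) := by
    intro σ hσ hσ1 hor
    refine ENNReal.toReal_le_of_le_ofReal (by positivity) ?_
    have h1 := h (r⁻¹ • x) (by rw [norm_smul, norm_inv, norm_norm, ← hr]; field_simp)
      (((max (τ - k) 0) ^ 2 - r ^ 2 - s ^ 2) / (2 * r * s)) (4 * k * (τ + k) / (2 * r * s)) σ
      (by positivity) hσ hσ1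
    refine le_trans (measure_mono ?_) (h1.trans (le_of_eq ?_))
    · rintro ω ⟨hω, ha, hb⟩
      rw [← hs] at ha hb
      set z : ℝ := inner ℝ (r⁻¹ • x) ω with hz
      have hxz : inner ℝ x ω = r * z := by
        rw [hz, inner_smul_left]; simp; field_simp
      have hlam : ‖x + s • ω‖ ^ 2 = r ^ 2 + s ^ 2 + 2 * r * s * z := by
        rw [norm_add_sq_real, inner_smul_right, hxz, norm_smul, hω, mul_one, Real.norm_eq_abs,
          sq_abs, ← hr]; ring
      have hl0 : 0 ≤ ‖x + s • ω‖ := norm_nonneg _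
      generalize ‖x + s • ω‖ = lam at *
      have hmx : max (τ - k) 0 ≤ lam := max_le ha hl0
      have hmx0 : 0 ≤ max (τ - k) 0 := le_max_right _ _
      have hq1 : (max (τ - k) 0) ^ 2 ≤ lam ^ 2 := by gcongr
      have hq2 : lam ^ 2 ≤ (τ + k) ^ 2 := by gcongr
      have hq3 : (τ + k) ^ 2 ≤ (max (τ - k) 0) ^ 2 + 4 * k * (τ + k) := by
        rcases le_total (τ - k) 0 with h5 | h5
        · rw [max_eq_right h5]; nlinarith
        · rw [max_eq_left h5]; nlinarith
      have hrs : 0 < 2 * r * s := by positivity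
      refine ⟨hω, ?_, ?_, ?_⟩
      · rw [div_le_iff₀ hrs]; nlinarith
      · rw [← add_div, le_div_iff₀ hrs]; nlinarith
      · rcases hor with h6 | h6
        · rw [h6]; nlinarith [sq_nonneg z]
        · have : r ^ 2 * (1 - z ^ 2) ≤ (τ + k) ^ 2 := by nlinarith [sq_nonneg (s + r * z)]
          calc 1 - z ^ 2 ≤ ((τ + k) / r) ^ 2 := by
                rw [div_pow, le_div_iff₀ (by positivity)]; linarith
            _ ≤ σ ^ 2 := by gcongr
            _ ≤ σ := by nlinarith
    · congr 1; field_simp; ring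
  have g1 := gen 1 one_pos le_rfl (Or.inl rfl)
  rw [one_pow, mul_one] at g1
  refine ⟨g1, ?_⟩
  rcases le_total ((τ + k) / r) 1 with h7 | h7
  · exact gen _ (by positivity) h7 (Or.inr le_rfl)
  · refine g1.trans (le_mul_of_one_le_right (by positivity) (one_le_pow₀ h7))

lemma DD_zero (n : ℕ) (k t τ : ℝ) (x : Rn n) (hτt : τ ≤ t)
    (h : 2 * τ < t - ‖x‖ - k ∨ t + ‖x‖ + k < 2 * τ) : (DD n k x t τ).toReal = 0 := by
  have : {ω : Rn n | ‖ω‖ = 1 ∧ τ - k ≤ ‖x + (t - τ) • ω‖ ∧ ‖x + (t - τ) • ω‖ ≤ τ + k} = ∅ := by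
    apply Set.eq_empty_of_forall_notMem
    rintro ω ⟨hω, ha, hb⟩
    have hn : ‖(t - τ) • ω‖ = t - τ := by
      rw [norm_smul, hω, mul_one, Real.norm_eq_abs, abs_of_nonneg (by linarith)]
    have h1 := norm_add_le x ((t - τ) • ω)
    have h2 : ‖(t - τ) • ω‖ ≤ ‖x + (t - τ) • ω‖ + ‖x‖ := by
      have := norm_sub_le (x + (t - τ) • ω) x
      simpa using this
    rcases h with h | h <;> linarith
  rw [DD, this]; simp

lemma qExp_odd (m : ℕ) (p : ℝ) : qExp (2 * m + 1) p = m * p - (m + 1) := by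
  unfold qExp; push_cast; ring

lemma wWt_odd (m : ℕ) (hm : 2 ≤ m) (k p r t : ℝ) : wWt (2 * m + 1) k p r t =
    if 0 < qExp (2 * m + 1) p then
      tauP k r t ^ (m : ℝ) * tauM k r t ^ qExp (2 * m + 1) p
    else if qExp (2 * m + 1) p = 0 then
      tauP k r t ^ (m : ℝ) * (Real.log (4 * tauP k r t / tauM k r t))⁻¹
    else tauP k r t ^ ((m : ℝ) + qExp (2 * m + 1) p) := by
  have hm0 : (0:ℝ) < m := by exact_mod_cast (by omega : 0 < m)
  have e1 : (((2 * m + 1 : ℕ) : ℝ) - 1) / 2 = m := by push_cast; ring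
  have e2 : (((2 * m + 1 : ℕ) : ℝ) + 1) / (((2 * m + 1 : ℕ) : ℝ) - 1) = (m + 1) / m := by
    push_cast; field_simp; ring
  have h1 : ((m : ℝ) + 1) / m < p ↔ 0 < qExp (2 * m + 1) p := by
    rw [div_lt_iff₀ hm0, qExp_odd]; constructor <;> intro h <;> linarith
  have h2 : p = ((m : ℝ) + 1) / m ↔ qExp (2 * m + 1) p = 0 := by
    rw [eq_div_iff hm0.ne', qExp_odd]; constructor <;> intro h <;> linarith
  unfold wWt
  rw [e1, e2]
  simp only [h1, h2]

lemma EnuOdd_odd (m : ℕ) (hm : 2 ≤ m) (p ν δ k T : ℝ) : EnuOdd (2 * m + 1) p ν δ k T =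
    if 0 < qExp (2 * m + 1) p then 1
    else if qExp (2 * m + 1) p = 0 then ((2 * T + 3 * k) / k) ^ (ν * δ)
    else ((2 * T + 3 * k) / k) ^ (-(ν * qExp (2 * m + 1) p)) := by
  have hm0 : (0:ℝ) < m := by exact_mod_cast (by omega : 0 < m)
  have e2 : (((2 * m + 1 : ℕ) : ℝ) + 1) / (((2 * m + 1 : ℕ) : ℝ) - 1) = (m + 1) / m := by
    push_cast; field_simp; ring
  have h1 : ((m : ℝ) + 1) / m < p ↔ 0 < qExp (2 * m + 1) p := by
    rw [div_lt_iff₀ hm0, qExp_odd]; constructor <;> intro h <;> linarith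
  have h2 : p = ((m : ℝ) + 1) / m ↔ qExp (2 * m + 1) p = 0 := by
    rw [eq_div_iff hm0.ne', qExp_odd]; constructor <;> intro h <;> linarith
  unfold EnuOdd
  rw [e2]
  simp only [h1, h2]

lemma int_bound (t lo hi : ℝ) (f G : ℝ → ℝ) (ht : 0 ≤ t) (hlh : lo ≤ hi)
    (hG : ∀ τ ∈ Set.Icc lo hi, 0 ≤ G τ) (hint : IntervalIntegrable G volume lo hi)
    (h : ∀ τ ∈ Set.Icc 0 t, τ ∈ Set.Icc lo hi → |f τ| ≤ G τ)
    (h0 : ∀ τ ∈ Set.Icc 0 t, τ ∉ Set.Icc lo hi → f τ = 0) :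
    |∫ τ in (0:ℝ)..t, f τ| ≤ ∫ τ in lo..hi, G τ := by
  rw [intervalIntegral.integral_of_le ht, intervalIntegral.integral_of_le hlh,
    ← integral_Icc_eq_integral_Ioc (x := lo)]
  rw [intervalIntegrable_iff_integrableOn_Icc_of_le hlh] at hint
  have hind : Integrable ((Set.Icc lo hi).indicator G) :=
    (integrable_indicator_iff measurableSet_Icc).2 hint
  have hnn : ∀ τ, 0 ≤ (Set.Icc lo hi).indicator G τ := fun τ => Set.indicator_nonneg hG τ
  have h1 := norm_integral_le_of_norm_le (f := f) (hind.restrict (s := Set.Ioc 0 t)) (by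
    refine (ae_restrict_iff' measurableSet_Ioc).2 (Filter.Eventually.of_forall ?_)
    intro τ hτ
    have hτ' : τ ∈ Set.Icc 0 t := ⟨hτ.1.le, hτ.2⟩
    by_cases hm : τ ∈ Set.Icc lo hi
    · rw [Set.indicator_of_mem hm]; exact h τ hτ' hm
    · rw [h0 τ hτ' hm, norm_zero]; exact hnn τ)
  rw [Real.norm_eq_abs] at h1
  refine h1.trans ?_
  refine (setIntegral_le_integral hind (Filter.Eventually.of_forall hnn)).trans (le_of_eq ?_)
  rw [integral_indicator measurableSet_Icc]

lemma wA (m : ℕ) (hm : 2 ≤ m) (k p r t : ℝ) (hM : 1 ≤ tauM k r t)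
    (hMP : tauM k r t ≤ tauP k r t) :
    0 ≤ wWt (2 * m + 1) k p r t ∧ wWt (2 * m + 1) k p r t ≤ tauP k r t ^ (m * p - 1) := by
  rw [wWt_odd m hm]
  have he : (m : ℝ) * p - 1 = m + qExp (2 * m + 1) p := by rw [qExp_odd]; ring
  rw [he]
  set q := qExp (2 * m + 1) p
  set P := tauP k r t
  set M := tauM k r t
  have hP : 0 < P := by linarith
  split_ifs with h1 h2
  · refine ⟨by positivity, ?_⟩
    rw [Real.rpow_add hP]
    gcongr
  · have hl : 1 ≤ Real.log (4 * P / M) := by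
      rw [Real.le_log_iff_exp_le (by positivity)]
      have : (4:ℝ) ≤ 4 * P / M := by rw [le_div_iff₀ (by linarith)]; linarith
      linarith [Real.exp_one_lt_d9]
    refine ⟨by positivity, ?_⟩
    rw [h2, add_zero]
    refine mul_le_of_le_one_right (by positivity) (inv_le_one_of_one_le₀ hl)
  · exact ⟨by positivity, le_rfl⟩

lemma wB (m : ℕ) (hm : 2 ≤ m) (p : ℝ) : ∃ C : ℝ, 0 < C ∧ ∀ k r t u0 u1 : ℝ,
    1 ≤ tauM k r t → tauM k r t ≤ tauP k r t → tauM k r t / 4 ≤ u0 → u0 ≤ u1 → u1 ≤ tauP k r t →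
    wWt (2 * m + 1) k p r t * ((tauP k r t ^ m)⁻¹ *
      ∫ v in u0..u1, v ^ (-1 - qExp (2 * m + 1) p)) ≤ C := by
  set q := qExp (2 * m + 1) p with hq
  refine ⟨4 ^ |q| / |q| + 1, by positivity, ?_⟩
  intro k r t u0 u1 hM hMP hu0 hu01 hu1
  rw [wWt_odd m hm, ← hq]
  set P := tauP k r t
  set M := tauM k r t
  have hP : 0 < P := by linarith
  have hu0' : 0 < u0 := by linarith
  have hu1' : 0 < u1 := by linarith
  have hnot : (0:ℝ) ∉ Set.uIcc u0 u1 := by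
    rw [Set.uIcc_of_le hu01]; intro h; linarith [h.1]
  have hint : q ≠ 0 → ∫ v in u0..u1, v ^ (-1 - q) = (u0 ^ (-q) - u1 ^ (-q)) / q := by
    intro h
    rw [integral_rpow (Or.inr ⟨by intro h'; apply h; linarith, hnot⟩)]
    have : -1 - q + 1 = -q := by ring
    rw [this, div_neg, ← neg_div]; congr 1; ring
  have hPm : P ^ (m : ℝ) = P ^ m := Real.rpow_natCast _ _
  have hPm0 : 0 < P ^ m := by positivity
  have hMM : 0 < M := by linarith
  split_ifs with h1 h2
  · rw [hint h1.ne', hPm, abs_of_pos h1]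
    calc P ^ m * M ^ q * ((P ^ m)⁻¹ * ((u0 ^ (-q) - u1 ^ (-q)) / q))
        = M ^ q * ((u0 ^ (-q) - u1 ^ (-q)) / q) := by field_simp
      _ ≤ M ^ q * (((M / 4) ^ (-q)) / q) := by
          gcongr
          have e1 : u0 ^ (-q) ≤ (M / 4) ^ (-q) :=
            Real.rpow_le_rpow_of_nonpos (by positivity) hu0 (by linarith)
          have e2 : 0 ≤ u1 ^ (-q) := by positivity
          linarith
      _ = 4 ^ q / q := by
          rw [Real.div_rpow hMM.le (by norm_num), Real.rpow_neg hMM.le,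
            Real.rpow_neg (by norm_num : (0:ℝ) ≤ 4)]
          have : M ^ q ≠ 0 := by positivity
          field_simp
      _ ≤ _ := by linarith
  · have : ∫ v in u0..u1, v ^ (-1 - q) = Real.log (u1 / u0) := by
      rw [h2, sub_zero, ← integral_inv hnot]
      simp only [Real.rpow_neg_one]
    rw [this, hPm]
    have hl : Real.log (u1 / u0) ≤ Real.log (4 * P / M) := by
      apply Real.log_le_log (by positivity)
      rw [div_le_div_iff₀ hu0' hMM]
      nlinarith
    have hl1 : 0 < Real.log (4 * P / M) := by
      apply Real.log_pos
      rw [lt_div_iff₀ hMM]; linarith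
    calc P ^ m * (Real.log (4 * P / M))⁻¹ * ((P ^ m)⁻¹ * Real.log (u1 / u0))
        = (Real.log (4 * P / M))⁻¹ * Real.log (u1 / u0) := by field_simp
      _ ≤ (Real.log (4 * P / M))⁻¹ * Real.log (4 * P / M) := by gcongr
      _ = 1 := by field_simp
      _ ≤ _ := by rw [h2]; simp
  · have h3 : q < 0 := lt_of_le_of_ne (not_lt.1 h1) h2
    rw [hint h2, Real.rpow_add hP, hPm, abs_of_neg h3]
    have h4 : (4:ℝ) ^ (-q) ≥ 1 := Real.one_le_rpow (by norm_num) (by linarith)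
    calc P ^ m * P ^ q * ((P ^ m)⁻¹ * ((u0 ^ (-q) - u1 ^ (-q)) / q))
        = P ^ q * ((u1 ^ (-q) - u0 ^ (-q)) / (-q)) := by field_simp; ring
      _ ≤ P ^ q * ((P ^ (-q)) / (-q)) := by
          have h5 : 0 < -q := by linarith
          gcongr
          have e1 : u1 ^ (-q) ≤ P ^ (-q) := Real.rpow_le_rpow hu1'.le hu1 h5.le
          have e2 : 0 ≤ u0 ^ (-q) := by positivity
          linarith
      _ = 1 / (-q) := by
          rw [Real.rpow_neg hP.le]
          have : P ^ q ≠ 0 := by positivity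
          field_simp
      _ ≤ 4 ^ (-q) / (-q) := by
          have h5 : 0 < -q := by linarith
          gcongr
      _ ≤ _ := by linarith

lemma calc_bound (m : ℕ) (hm : 2 ≤ m) (p : ℝ) (hp : 1 < p) (C0 : ℝ) (hC0 : 0 < C0) :
    ∃ C : ℝ, 0 < C ∧ ∀ (k t r K : ℝ) (D f : ℝ → ℝ), 0 < k → 0 ≤ t → 0 ≤ r → r ≤ t + k → 0 ≤ K →
      (∀ τ ∈ Set.Icc 0 t, 0 ≤ D τ ∧ D τ ≤ C0) →
      (∀ τ, 0 ≤ τ → τ < t → 0 < r → D τ ≤ C0 * (k * (τ + k) / (r * (t - τ))) ∧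
        D τ ≤ C0 * (k * (τ + k) / (r * (t - τ))) * ((τ + k) / r) ^ (m - 1)) →
      (∀ τ ∈ Set.Icc 0 t, 2 * τ < t - r - k ∨ t + r + k < 2 * τ → D τ = 0) →
      (∀ τ ∈ Set.Icc 0 t, |f τ| ≤ K * ((t - τ) * D τ * (τ / k + 1) ^ (-(m * p)))) →
      wWt (2 * m + 1) k p r t * |∫ τ in (0:ℝ)..t, f τ| ≤ C * K * k ^ 2 := by
  obtain ⟨C2, hC2, hwB⟩ := wB m hm p
  set a : ℝ := m * p with ha
  have hm2 : (2:ℝ) ≤ m := by exact_mod_cast hm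
  have ha1 : 1 < a := by rw [ha]; nlinarith
  refine ⟨2 * C0 * 8 ^ a + C0 * 5 ^ m * C2, by positivity, ?_⟩
  intro k t r K D f hk ht hr hrt hK hD1 hD2 hD4 hf
  set P := tauP k r t with hPdef
  set M := tauM k r t with hMdef
  have hPk : k * P = t + r + 2 * k := by rw [hPdef, tauP]; field_simp
  have hMk : k * M = t - r + 2 * k := by rw [hMdef, tauM]; field_simp
  have hM1 : 1 ≤ M := by
    by_contra h; push Not at h; nlinarith
  have hMP : M ≤ P := by
    by_contra h; push Not at h; nlinarith
  have hP : 0 < P := by linarith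
  obtain ⟨hw0, hw1⟩ := wA m hm k p r t hM1 hMP
  set w := wWt (2 * m + 1) k p r t with hw
  have hfz : ∀ τ ∈ Set.Icc 0 t, D τ = 0 → f τ = 0 := by
    intro τ hτ h
    have := hf τ hτ
    rw [h, mul_zero, zero_mul, mul_zero] at this
    exact abs_nonpos_iff.1 this
  by_cases hcase : r ≤ k ∨ r ≤ t / 2
  · -- interior
    set Q : ℝ := K * (C0 * 8 ^ a * P ^ (1 - a) * k ^ 2 / max r k) with hQ
    have hmax : 0 < max r k := lt_max_of_lt_right hk
    have hQ0 : 0 ≤ Q := by positivity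
    have hI := int_bound t ((t - r - k) / 2) ((t + r + k) / 2) f (fun _ => Q) ht (by linarith)
      (fun _ _ => hQ0) intervalIntegrable_const ?_ ?_
    · rw [intervalIntegral.integral_const, smul_eq_mul] at hI
      have h1 : w * |∫ τ in (0:ℝ)..t, f τ| ≤
          P ^ (a - 1) * (((t + r + k) / 2 - (t - r - k) / 2) * Q) := by
        gcongr
      refine h1.trans ?_
      have h2 : P ^ (a - 1) * P ^ (1 - a) = 1 := by
        rw [← Real.rpow_add hP]; simp
      have h3 : (r + k) / max r k ≤ 2 := by
        rw [div_le_iff₀ hmax]; linarith [le_max_left r k, le_max_right r k]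
      calc P ^ (a - 1) * (((t + r + k) / 2 - (t - r - k) / 2) * Q)
          = (P ^ (a - 1) * P ^ (1 - a)) * ((r + k) / max r k) * (C0 * 8 ^ a * K * k ^ 2) := by
            rw [hQ]; ring
        _ ≤ 1 * 2 * (C0 * 8 ^ a * K * k ^ 2) := by rw [h2]; gcongr
        _ ≤ 1 * 2 * (C0 * 8 ^ a * K * k ^ 2) + C0 * 5 ^ m * C2 * K * k ^ 2 :=
            le_add_of_nonneg_right (by positivity)
        _ = _ := by ring
    · intro τ hτ hτ2
      obtain ⟨l1, l2⟩ := hτ2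
      obtain ⟨b1, b2⟩ := hτ
      refine (hf τ ⟨b1, b2⟩).trans ?_
      rw [hQ]
      refine mul_le_mul_of_nonneg_left ?_ hK
      set u := τ / k + 1 with hu
      have huk : k * u = τ + k := by rw [hu]; field_simp
      have hu1 : 1 ≤ u := by rw [hu]; have : 0 ≤ τ / k := by positivity
                             linarith
      have huP : P / 8 ≤ u := by
        have : k * P ≤ k * (8 * u) := by
          rcases hcase with h | h <;> linarith
        have := le_of_mul_le_mul_left this hk
        linarith
      obtain ⟨d1, d2⟩ := hD1 τ ⟨b1, b2⟩
      have hupow : u ^ (-a) ≤ 8 ^ a * P ^ (-a) := by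
        calc u ^ (-a) ≤ (P / 8) ^ (-a) :=
              Real.rpow_le_rpow_of_nonpos (by positivity) huP (by linarith)
          _ = _ := by
            rw [Real.div_rpow hP.le (by norm_num), Real.rpow_neg (by norm_num : (0:ℝ) ≤ 8)]
            field_simp
      have hupow1 : u ^ (1 - a) ≤ 8 ^ a * P ^ (1 - a) := by
        calc u ^ (1 - a) ≤ (P / 8) ^ (1 - a) :=
              Real.rpow_le_rpow_of_nonpos (by positivity) huP (by linarith)
          _ = 8 ^ (a - 1) * P ^ (1 - a) := by
            rw [Real.div_rpow hP.le (by norm_num), ← neg_sub a 1, 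
              Real.rpow_neg (by norm_num : (0:ℝ) ≤ 8)]
            field_simp
          _ ≤ _ := by
            gcongr
            · norm_num
            · linarith
      rcases le_or_gt r k with hrk | hrk
      · rw [max_eq_right hrk]
        calc (t - τ) * D τ * u ^ (-a) ≤ (k * P) * C0 * (8 ^ a * P ^ (-a)) := by
              gcongr
              linarith
          _ = C0 * 8 ^ a * P ^ (1 - a) * k ^ 2 / k := by
              rw [sub_eq_add_neg, Real.rpow_add hP, Real.rpow_one]; field_simp
      · rw [max_eq_left hrk.le]
        have hr0 : 0 < r := hk.trans hrk
        rcases b2.eq_or_lt with h | h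
        · rw [h, sub_self, zero_mul, zero_mul]; positivity
        have hs : 0 < t - τ := by linarith
        have h5 := (hD2 τ b1 h hr0).1
        rw [← huk] at h5
        calc (t - τ) * D τ * u ^ (-a)
            ≤ (t - τ) * (C0 * (k * (k * u) / (r * (t - τ)))) * u ^ (-a) := by gcongr
          _ = C0 * k ^ 2 / r * (u * u ^ (-a)) := by field_simp
          _ = C0 * k ^ 2 / r * (u ^ (1 - a)) := by
              rw [sub_eq_add_neg, Real.rpow_add (by linarith), Real.rpow_one]
          _ ≤ C0 * k ^ 2 / r * (8 ^ a * P ^ (1 - a)) := by gcongr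
          _ = _ := by ring
    · intro τ hτ hτ2
      apply hfz τ hτ
      apply hD4 τ hτ
      by_contra h
      push Not at h
      exact hτ2 ⟨by linarith, by linarith⟩
  · push Not at hcase
    obtain ⟨hrk, hrt2⟩ := hcase
    have hr0 : 0 < r := hk.trans hrk
    set q := qExp (2 * m + 1) p with hq
    have hqa : (m : ℝ) - a = -1 - q := by rw [hq, qExp_odd]; ring
    set lo := max 0 ((t - r - k) / 2) with hlo
    have hlo0 : 0 ≤ lo := le_max_left _ _
    have hlot : lo ≤ t := max_le ht (by linarith)
    set c : ℝ := K * C0 * k * 5 ^ m * (P ^ m)⁻¹ with hc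
    have hc0 : 0 ≤ c := by positivity
    have hupos : ∀ τ ∈ Set.Icc lo t, 1 ≤ τ / k + 1 := by
      intro τ hτ
      have : 0 ≤ τ / k := div_nonneg (hlo0.trans hτ.1) hk.le
      linarith
    have hI := int_bound t lo t f (fun τ => c * (τ / k + 1) ^ (-1 - q)) ht hlot ?_ ?_ ?_ ?_
    · rw [intervalIntegral.integral_const_mul,
        intervalIntegral.integral_comp_div_add (fun v : ℝ => v ^ (-1 - q)) hk.ne', smul_eq_mul] at hI
      have h4 := hwB k r t (lo / k + 1) (t / k + 1) hM1 hMP ?_ ?_ ?_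
      · calc w * |∫ τ in (0:ℝ)..t, f τ|
            ≤ w * (c * (k * ∫ v in (lo / k + 1)..(t / k + 1), v ^ (-1 - q))) := by gcongr
          _ = (w * ((P ^ m)⁻¹ * ∫ v in (lo / k + 1)..(t / k + 1), v ^ (-1 - q))) *
              (K * C0 * k ^ 2 * 5 ^ m) := by rw [hc]; ring
          _ ≤ C2 * (K * C0 * k ^ 2 * 5 ^ m) := by gcongr
          _ ≤ 2 * C0 * 8 ^ a * K * k ^ 2 + C2 * (K * C0 * k ^ 2 * 5 ^ m) :=
              le_add_of_nonneg_left (by positivity)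
          _ = _ := by ring
      · rw [← hMdef]
        have h6 : (t - r - k) / 2 ≤ lo := le_max_right _ _
        have : k * M ≤ k * (4 * (lo / k + 1)) := by
          have : k * (4 * (lo / k + 1)) = 4 * (lo + k) := by field_simp
          rw [this, hMk]; linarith
        have := le_of_mul_le_mul_left this hk
        linarith
      · gcongr
      · rw [← hPdef]
        have : k * (t / k + 1) ≤ k * P := by
          have : k * (t / k + 1) = t + k := by field_simp
          rw [this, hPk]; linarith
        exact le_of_mul_le_mul_left this hk
    · intro τ hτ
      have := hupos τ hτ
      positivity
    · apply ContinuousOn.intervalIntegrable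
      rw [Set.uIcc_of_le hlot]
      apply ContinuousOn.mul continuousOn_const
      apply ContinuousOn.rpow_const (by fun_prop)
      intro τ hτ
      left
      linarith [hupos τ hτ]
    · intro τ hτ hτ2
      obtain ⟨b1, b2⟩ := hτ
      have hu1 := hupos τ hτ2
      refine (hf τ ⟨b1, b2⟩).trans ?_
      set u := τ / k + 1 with hu
      have huk : k * u = τ + k := by rw [hu]; field_simp
      have hu0 : 0 < u := by linarith
      have hrP : k / r ≤ 5 / P := by
        rw [div_le_div_iff₀ hr0 hP, hPk]; linarith
      rcases b2.eq_or_lt with h | h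
      · rw [h, sub_self, zero_mul, zero_mul, mul_zero]; positivity
      have hs : 0 < t - τ := by linarith
      have h5 := (hD2 τ b1 h hr0).2
      rw [← huk] at h5
      have hmm : m = (m - 1) + 1 := by omega
      calc K * ((t - τ) * D τ * u ^ (-a))
          ≤ K * ((t - τ) * (C0 * (k * (k * u) / (r * (t - τ))) * (k * u / r) ^ (m - 1)) * u ^ (-a)) := by
            gcongr
        _ = K * (C0 * k * ((k * u / r) ^ (m - 1) * (k * u / r)) * u ^ (-a)) := by
            field_simp
        _ = K * (C0 * k * (k * u / r) ^ m * u ^ (-a)) := by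
            rw [← pow_succ, ← hmm]
        _ = K * C0 * k * (k / r) ^ m * (u ^ m * u ^ (-a)) := by
            rw [mul_div_right_comm, mul_pow]; ring
        _ = K * C0 * k * (k / r) ^ m * u ^ (-1 - q) := by
            rw [← hqa, sub_eq_add_neg, Real.rpow_add hu0, Real.rpow_natCast]
        _ ≤ K * C0 * k * (5 / P) ^ m * u ^ (-1 - q) := by gcongr
        _ = c * u ^ (-1 - q) := by rw [hc, div_pow]; ring
    · intro τ hτ hτ2
      apply hfz τ hτ
      apply hD4 τ hτ
      left
      by_contra h
      push Not at h
      exact hτ2 ⟨max_le hτ.1 (by linarith), hτ.2⟩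

lemma weight_low (m : ℕ) (hm : 2 ≤ m) (p ν δ : ℝ) (hν₀ : 0 ≤ ν) (hδ : 0 < δ) :
    ∃ C : ℝ, 0 < C ∧ ∀ k T r τ : ℝ, 0 < k → 0 ≤ τ → τ ≤ T → 0 ≤ r → τ - k ≤ r → r ≤ τ + k →
      ∃ X : ℝ, 0 < X ∧ tauP k r τ ^ m ≤ wWt (2 * m + 1) k p r τ * X ∧
        X ^ ν ≤ C * EnuOdd (2 * m + 1) p ν δ k T := by
  refine ⟨1 + (4 ^ δ / δ) ^ ν, by positivity, ?_⟩
  intro k T r τ hk hτ hτT hr h1 h2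
  rw [wWt_odd m hm, EnuOdd_odd m hm]
  set q := qExp (2 * m + 1) p
  set P := tauP k r τ with hPdef
  set M := tauM k r τ with hMdef
  have hPk : k * P = τ + r + 2 * k := by rw [hPdef, tauP]; field_simp
  have hMk : k * M = τ - r + 2 * k := by rw [hMdef, tauM]; field_simp
  have hM1 : 1 ≤ M := by
    by_contra h; push Not at h; nlinarith
  have hMP : M ≤ P := by
    by_contra h; push Not at h; nlinarith
  have hP : 0 < P := by linarith
  have hMM : 0 < M := by linarith
  have hΘ : P ≤ (2 * T + 3 * k) / k := by
    rw [le_div_iff₀ hk]; linarith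
  have hC : 0 ≤ (4 ^ δ / δ) ^ ν := by positivity
  rw [Real.rpow_natCast]
  have hPm : 0 < P ^ m := by positivity
  split_ifs with c1 c2
  · refine ⟨1, one_pos, ?_, ?_⟩
    · rw [mul_one]
      exact le_mul_of_one_le_right hPm.le (Real.one_le_rpow hM1 c1.le)
    · rw [Real.one_rpow]; linarith
  · have hl1 : 0 < Real.log (4 * P / M) := by
      apply Real.log_pos
      rw [lt_div_iff₀ hMM]; linarith
    refine ⟨Real.log (4 * P / M), hl1, ?_, ?_⟩
    · apply le_of_eq; field_simp
    · have h3 : Real.log (4 * P / M) ≤ 4 ^ δ / δ * P ^ δ := by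
        calc Real.log (4 * P / M) ≤ Real.log (4 * P) := by
              apply Real.log_le_log (by positivity)
              exact div_le_self (by positivity) hM1
          _ ≤ (4 * P) ^ δ / δ := Real.log_le_rpow_div (by positivity) hδ
          _ = _ := by rw [Real.mul_rpow (by norm_num) hP.le]; ring
      calc Real.log (4 * P / M) ^ ν ≤ (4 ^ δ / δ * P ^ δ) ^ ν := by gcongr
        _ = (4 ^ δ / δ) ^ ν * P ^ (ν * δ) := by
            rw [Real.mul_rpow (by positivity) (by positivity), ← Real.rpow_mul hP.le, mul_comm δ]
        _ ≤ (4 ^ δ / δ) ^ ν * ((2 * T + 3 * k) / k) ^ (ν * δ) := by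
            gcongr
        _ ≤ _ := by
            have : 0 ≤ ((2 * T + 3 * k) / k) ^ (ν * δ) := by
              apply Real.rpow_nonneg; linarith
            linarith
  · have h3 : q < 0 := lt_of_le_of_ne (not_lt.1 c1) c2
    refine ⟨P ^ (-q), by positivity, ?_, ?_⟩
    · rw [← Real.rpow_add hP]; apply le_of_eq; simp
    · rw [← Real.rpow_mul hP.le]
      have e : -q * ν = -(ν * q) := by ring
      rw [e]
      have h4 : 0 ≤ -(ν * q) := by nlinarith
      have h5 : P ^ (-(ν * q)) ≤ ((2 * T + 3 * k) / k) ^ (-(ν * q)) := by gcongr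
      have h6 : 0 ≤ P ^ (-(ν * q)) := by positivity
      nlinarith

lemma mop_bound (m : ℕ) (hm : 2 ≤ m) (φ : Rn (2 * m + 1) → ℝ) (x : Rn (2 * m + 1)) (k t τ Q : ℝ)
    (h1 : ∀ y, τ - k ≤ ‖y‖ → ‖y‖ ≤ τ + k → |φ y| ≤ Q)
    (h0 : ∀ y, ‖y‖ < τ - k ∨ τ + k < ‖y‖ → φ y = 0) :
    |Mop (2 * m + 1) φ x (t - τ)| ≤
      |1 / omegaN (2 * m + 1)| * (Q * (DD (2 * m + 1) k x t τ).toReal) := by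
  obtain ⟨C, hC, hS⟩ := sphere_fin m hm
  set μ : Measure (Rn (2 * m + 1)) := Measure.hausdorffMeasure (((2 * m + 1 : ℕ) : ℝ) - 1) with hμ
  set A : Set (Rn (2 * m + 1)) :=
    {ω | τ - k ≤ ‖x + (t - τ) • ω‖ ∧ ‖x + (t - τ) • ω‖ ≤ τ + k} with hA
  have hAm : MeasurableSet A := by
    apply IsClosed.measurableSet
    have hc : Continuous (fun ω : Rn (2 * m + 1) => ‖x + (t - τ) • ω‖) := by fun_prop
    exact (isClosed_le continuous_const hc).inter (isClosed_le hc continuous_const)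
  have hsph : Metric.sphere (0 : Rn (2 * m + 1)) 1 = {ω | ‖ω‖ = 1} := by
    ext ω; simp
  have hfin : IsFiniteMeasure (μ.restrict (Metric.sphere (0 : Rn (2 * m + 1)) 1)) := by
    constructor
    rw [Measure.restrict_apply_univ, hsph]
    exact lt_of_le_of_lt hS ENNReal.ofReal_lt_top
  unfold Mop
  rw [if_pos (by omega), abs_mul]
  refine mul_le_mul_of_nonneg_left ?_ (abs_nonneg _)
  have key := norm_integral_le_of_norm_le (μ := μ.restrict (Metric.sphere (0 : Rn (2 * m + 1)) 1))
    (f := fun ω => φ (x + (t - τ) • ω)) (g := A.indicator (fun _ => Q))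
    ((integrable_const Q).indicator hAm) (Filter.Eventually.of_forall ?_)
  · rw [Real.norm_eq_abs] at key
    refine key.trans (le_of_eq ?_)
    rw [integral_indicator hAm, setIntegral_const, smul_eq_mul, mul_comm, Measure.real,
      Measure.restrict_apply hAm, DD, hsph]
    congr 3
    ext ω
    simp only [hA, Set.mem_inter_iff, Set.mem_ofPred_eq]
    tauto
  · intro ω
    by_cases hω : ω ∈ A
    · rw [Set.indicator_of_mem hω]; exact h1 _ hω.1 hω.2
    · rw [Set.indicator_of_notMem hω, h0, norm_zero]
      by_contra h
      push Not at h
      exact hω h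

/-- **A priori estimate with the linear part, odd dimensions** (Lemma 4.2):
for odd `n ≥ 5`, `p > 1`, `0 ≤ ν < p` and `δ > 0` there is `C_{n,ν,p} > 0` such that
`‖L(|U₀|^{p−ν}|U|^ν)‖ ≤ C_{n,ν,p} k² N₀^{p−ν} ‖U‖^ν E_ν(T)`. -/
theorem apriori_estimate_odd_linear (n m : ℕ) (hnm : n = 2 * m + 1) (hn : 5 ≤ n)
    (p ν δ : ℝ) (hp : 1 < p) (hν₀ : 0 ≤ ν) (hνp : ν < p) (hδ : 0 < δ) :
    ∃ C : ℝ, 0 < C ∧ ∀ k T : ℝ, 0 < k → 0 < T → ∀ U U₀ : Rn n → ℝ → ℝ,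
      ContinuousOn (fun pr : Rn n × ℝ => U pr.1 pr.2) (Set.univ ×ˢ Set.Icc 0 T) →
      ContinuousOn (fun pr : Rn n × ℝ => U₀ pr.1 pr.2) (Set.univ ×ˢ Set.Icc 0 T) →
      (∀ x : Rn n, ∀ t ∈ Set.Icc (0:ℝ) T, t + k < ‖x‖ → U x t = 0) →
      (∀ x : Rn n, ∀ t ∈ Set.Icc (0:ℝ) T, ‖x‖ < t - k ∨ t + k < ‖x‖ → U₀ x t = 0) →
      BddAbove ((fun pr : Rn n × ℝ => wWt n k p ‖pr.1‖ pr.2 * |U pr.1 pr.2|) ''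
        (Set.univ ×ˢ Set.Icc 0 T)) →
      BddAbove ((fun pr : Rn n × ℝ =>
          tauP k ‖pr.1‖ pr.2 ^ (((n : ℝ) - 1) / 2) * |U₀ pr.1 pr.2|) ''
        (Set.univ ×ˢ Set.Icc 0 T)) →
      ∀ x : Rn n, ∀ t ∈ Set.Icc (0:ℝ) T,
        wWt n k p ‖x‖ t * |Lop n (fun y τ => |U₀ y τ| ^ (p - ν) * |U y τ| ^ ν) x t| ≤
          C * k ^ 2 * NzeroOdd n k T U₀ ^ (p - ν) * wNorm n k p T U ^ ν *
            EnuOdd n p ν δ k T := by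
  subst hnm
  have hm : 2 ≤ m := by omega
  have hm2 : (2:ℝ) ≤ m := by exact_mod_cast hm
  obtain ⟨CS, hCS, hS⟩ := sphere_fin m hm
  obtain ⟨CL, hCL, hsl⟩ := slice m hm
  obtain ⟨C1, hC1, hwl⟩ := weight_low m hm p ν δ hν₀ hδ
  obtain ⟨C2, hC2, hcalc⟩ := calc_bound m hm p hp (CS + CL) (by positivity)
  set Ω := |1 / omegaN (2 * m + 1)| with hΩ
  have hΩ0 : 0 ≤ Ω := abs_nonneg _
  set Z := |1 / (2 * (((2 * m + 1) / 2 : ℕ) : ℝ) - 1)| with hZ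
  have hZ0 : 0 ≤ Z := abs_nonneg _
  refine ⟨Z * C2 * Ω * C1 + 1, by positivity, ?_⟩
  intro k T hk hT U U₀ _ _ hU hU₀ hbU hbU₀ x t ht
  have e1 : (((2 * m + 1 : ℕ) : ℝ) - 1) / 2 = m := by push_cast; ring
  set N := NzeroOdd (2 * m + 1) k T U₀ with hN
  set W := wNorm (2 * m + 1) k p T U with hW
  set E := EnuOdd (2 * m + 1) p ν δ k T with hE
  set Ψ : Rn (2 * m + 1) → ℝ → ℝ := fun y τ => |U₀ y τ| ^ (p - ν) * |U y τ| ^ ν with hΨ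
  have hpν : 0 < p - ν := by linarith
  have hNle : ∀ y : Rn (2 * m + 1), ∀ τ ∈ Set.Icc (0:ℝ) T,
      tauP k ‖y‖ τ ^ m * |U₀ y τ| ≤ N := by
    intro y τ hτ
    have := le_csSup hbU₀ ⟨(y, τ), ⟨Set.mem_univ _, hτ⟩, rfl⟩
    simp only [e1, Real.rpow_natCast] at this
    rw [hN, NzeroOdd]
    simp only [e1, Real.rpow_natCast]
    exact this
  have hWle : ∀ y : Rn (2 * m + 1), ∀ τ ∈ Set.Icc (0:ℝ) T,
      wWt (2 * m + 1) k p ‖y‖ τ * |U y τ| ≤ W := by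
    intro y τ hτ
    exact le_csSup hbU ⟨(y, τ), ⟨Set.mem_univ _, hτ⟩, rfl⟩
  have h0T : (0:ℝ) ∈ Set.Icc (0:ℝ) T := ⟨le_rfl, hT.le⟩
  have hN0 : 0 ≤ N := by
    refine le_trans ?_ (hNle 0 0 h0T)
    have : 0 ≤ tauP k ‖(0 : Rn (2 * m + 1))‖ 0 := by
      unfold tauP; simp only [norm_zero]; positivity
    positivity
  have hW0 : 0 ≤ W := by
    refine le_trans ?_ (hWle 0 0 h0T)
    have hM : 1 ≤ tauM k ‖(0 : Rn (2 * m + 1))‖ 0 := by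
      unfold tauM; simp only [norm_zero]; rw [le_div_iff₀ hk]; linarith
    have hMP : tauM k ‖(0 : Rn (2 * m + 1))‖ 0 ≤ tauP k ‖(0 : Rn (2 * m + 1))‖ 0 := by
      unfold tauM tauP; simp
    exact mul_nonneg (wA m hm k p _ _ hM hMP).1 (abs_nonneg _)
  have hE0 : 0 ≤ E := by
    rw [hE]; unfold EnuOdd
    split_ifs <;> positivity
  -- pointwise bound on the integrand
  have hΨ0 : ∀ y : Rn (2 * m + 1), ∀ τ ∈ Set.Icc (0:ℝ) T,
      ‖y‖ < τ - k ∨ τ + k < ‖y‖ → Ψ y τ = 0 := by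
    intro y τ hτ h
    simp only [hΨ]
    rw [hU₀ y τ hτ h, abs_zero, Real.zero_rpow hpν.ne', zero_mul]
  have hΨ1 : ∀ y : Rn (2 * m + 1), ∀ τ ∈ Set.Icc (0:ℝ) T,
      τ - k ≤ ‖y‖ → ‖y‖ ≤ τ + k →
      |Ψ y τ| ≤ C1 * N ^ (p - ν) * W ^ ν * E * (τ / k + 1) ^ (-(m * p)) := by
    intro y τ hτ ha hb
    obtain ⟨X, hX, hX1, hX2⟩ := hwl k T ‖y‖ τ hk hτ.1 hτ.2 (norm_nonneg y) ha hb
    have hn := hNle y τ hτ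
    have hw := hWle y τ hτ
    have hτ0 := hτ.1
    have hP1 : τ / k + 1 ≤ tauP k ‖y‖ τ := by
      have : tauP k ‖y‖ τ = τ / k + 1 + (‖y‖ / k + 1) := by unfold tauP; field_simp; ring
      rw [this]
      have : 0 ≤ ‖y‖ / k := by positivity
      linarith
    have hu : 0 < τ / k + 1 := by positivity
    generalize tauP k ‖y‖ τ = P at *
    have hP : 0 < P := by linarith
    have hPm : 0 < P ^ m := by positivity
    have hA : |U₀ y τ| ≤ N * (P ^ m)⁻¹ := by
      rw [← div_eq_mul_inv, le_div_iff₀ hPm]; linarith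
    have hB : |U y τ| ≤ W * X * (P ^ m)⁻¹ := by
      rw [← div_eq_mul_inv, le_div_iff₀ hPm]
      have h0 := abs_nonneg (U y τ)
      calc |U y τ| * P ^ m ≤ |U y τ| * (wWt (2 * m + 1) k p ‖y‖ τ * X) := by gcongr
        _ = (wWt (2 * m + 1) k p ‖y‖ τ * |U y τ|) * X := by ring
        _ ≤ W * X := by gcongr
    have hnn : 0 ≤ Ψ y τ := by simp only [hΨ]; positivity
    rw [abs_of_nonneg hnn]
    calc Ψ y τ ≤ (N * (P ^ m)⁻¹) ^ (p - ν) * (W * X * (P ^ m)⁻¹) ^ ν := by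
          simp only [hΨ]; gcongr
      _ = N ^ (p - ν) * W ^ ν * X ^ ν * (((P ^ m)⁻¹) ^ (p - ν) * ((P ^ m)⁻¹) ^ ν) := by
          rw [Real.mul_rpow hN0 (by positivity), Real.mul_rpow (by positivity) (by positivity),
            Real.mul_rpow hW0 hX.le]
          ring
      _ = N ^ (p - ν) * W ^ ν * X ^ ν * P ^ (-(m * p)) := by
          rw [← Real.rpow_add (by positivity), sub_add_cancel, ← Real.rpow_natCast P m,
            ← Real.rpow_neg hP.le, ← Real.rpow_mul hP.le]
          congr 2; ring
      _ ≤ N ^ (p - ν) * W ^ ν * (C1 * E) * (τ / k + 1) ^ (-(m * p)) := by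
          have h5 : P ^ (-(m * p)) ≤ (τ / k + 1) ^ (-(m * p)) :=
            Real.rpow_le_rpow_of_nonpos hu hP1 (by nlinarith)
          gcongr
      _ = _ := by ring
  set K0 := C1 * N ^ (p - ν) * W ^ ν * E with hK0
  have hK00 : 0 ≤ K0 := by positivity
  set f : ℝ → ℝ := fun τ => (t - τ) * Mop (2 * m + 1) (fun y => Ψ y τ) x (t - τ) with hf
  set D : ℝ → ℝ := fun τ => (DD (2 * m + 1) k x t τ).toReal with hD
  have hfb : ∀ τ ∈ Set.Icc 0 t,
      |f τ| ≤ (Ω * K0) * ((t - τ) * D τ * (τ / k + 1) ^ (-(m * p))) := by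
    intro τ hτ
    have hτT : τ ∈ Set.Icc (0:ℝ) T := ⟨hτ.1, hτ.2.trans ht.2⟩
    have h3 := mop_bound m hm (fun y => Ψ y τ) x k t τ (K0 * (τ / k + 1) ^ (-(m * p)))
      (fun y => hΨ1 y τ hτT) (fun y => hΨ0 y τ hτT)
    have hs : 0 ≤ t - τ := by linarith [hτ.2]
    simp only [hf]
    rw [abs_mul, abs_of_nonneg hs]
    refine (mul_le_mul_of_nonneg_left h3 hs).trans (le_of_eq ?_)
    simp only [hD, hΩ]; ring
  have hL : |Lop (2 * m + 1) Ψ x t| = Z * |∫ τ in (0:ℝ)..t, f τ| := by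
    unfold Lop; rw [abs_mul]
  rw [hL]
  have hfinal : wWt (2 * m + 1) k p ‖x‖ t * |∫ τ in (0:ℝ)..t, f τ| ≤ C2 * (Ω * K0) * k ^ 2 := by
    rcases le_or_gt ‖x‖ (t + k) with hxt | hxt
    · refine hcalc k t ‖x‖ (Ω * K0) D f hk ht.1 (norm_nonneg x) hxt (by positivity) ?_ ?_ ?_ hfb
      · intro τ _
        refine ⟨ENNReal.toReal_nonneg, ?_⟩
        have : D τ ≤ CS := by
          apply ENNReal.toReal_le_of_le_ofReal hCS.le
          exact (measure_mono (fun ω hω => hω.1)).trans hS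
        linarith
      · intro τ hτ hτt hx0
        obtain ⟨g1, g2⟩ := hsl k t τ x hk hτ hτt (norm_pos_iff.1 hx0)
        have hs : 0 < t - τ := by linarith
        constructor
        · refine g1.trans ?_
          gcongr
          linarith
        · refine g2.trans ?_
          gcongr
          linarith
      · intro τ hτ h
        exact DD_zero _ k t τ x hτ.2 h
    · have hz : ∫ τ in (0:ℝ)..t, f τ = 0 := by
        apply intervalIntegral.integral_zero_ae
        refine Filter.Eventually.of_forall ?_
        intro τ hτ
        rw [Set.uIoc_of_le ht.1] at hτ
        have hτ' : τ ∈ Set.Icc 0 t := ⟨hτ.1.le, hτ.2⟩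
        have h3 := hfb τ hτ'
        have hd : D τ = 0 := by
          have : {ω : Rn (2 * m + 1) | ‖ω‖ = 1 ∧ τ - k ≤ ‖x + (t - τ) • ω‖ ∧
              ‖x + (t - τ) • ω‖ ≤ τ + k} = ∅ := by
            apply Set.eq_empty_of_forall_notMem
            rintro ω ⟨hω, _, hb⟩
            have hn : ‖(t - τ) • ω‖ = t - τ := by
              rw [norm_smul, hω, mul_one, Real.norm_eq_abs, abs_of_nonneg (by linarith [hτ.2])]
            have h2 : ‖x‖ ≤ ‖x + (t - τ) • ω‖ + ‖(t - τ) • ω‖ := by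
              have := norm_sub_le (x + (t - τ) • ω) ((t - τ) • ω)
              simpa using this
            linarith
          simp only [hD, DD]
          rw [this]; simp
        rw [hd, mul_zero, zero_mul, mul_zero] at h3
        exact abs_nonpos_iff.1 h3
      rw [hz, abs_zero, mul_zero]; positivity
  have hR : 0 ≤ k ^ 2 * N ^ (p - ν) * W ^ ν * E := by positivity
  calc wWt (2 * m + 1) k p ‖x‖ t * (Z * |∫ τ in (0:ℝ)..t, f τ|)
      = Z * (wWt (2 * m + 1) k p ‖x‖ t * |∫ τ in (0:ℝ)..t, f τ|) := by ring
    _ ≤ Z * (C2 * (Ω * K0) * k ^ 2) := by gcongr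
    _ = (Z * C2 * Ω * C1) * (k ^ 2 * N ^ (p - ν) * W ^ ν * E) := by rw [hK0]; ring
    _ ≤ (Z * C2 * Ω * C1 + 1) * (k ^ 2 * N ^ (p - ν) * W ^ ν * E) := by
        gcongr; linarith
    _ = _ := by ring
end
end

section
/- Let n ≥ 3 and h(λ,ρ,r) = {λ² − (ρ−r)²}^{(n−3)/2} {(ρ+r)² − λ²}^{(n−3)/2}. Suppose r > 0, ρ ≥ 0 and |ρ − r| ≤ λ ≤ ρ + r. Then |λ − r| ≤ ρ ≤ λ + r, and there exists a constant C = C(n) > 0 such that the following three estimates hold: h(λ,ρ,r) ≤ C r^{n−3} λ^{n−3}; h(λ,ρ,r) ≤ C ρ^{n−3} r^{(n−3)/2} λ^{(n−3)/2}; and h(λ,ρ,r) ≤ C r^{n−3} ρ^{n−3}. -/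
open MeasureTheory Real
open scoped Classical

noncomputable section

/-- The kernel `h(λ,ρ,r) = {λ²−(ρ−r)²}^{(n−3)/2}{(ρ+r)²−λ²}^{(n−3)/2}`. -/
def hKer (n : ℕ) (lam ρ r : ℝ) : ℝ :=
  (lam ^ 2 - (ρ - r) ^ 2) ^ (((n : ℝ) - 3) / 2) * ((ρ + r) ^ 2 - lam ^ 2) ^ (((n : ℝ) - 3) / 2)

/-- **Estimates of the kernel `h`** (Lemma 4.8): if `|ρ−r| ≤ λ ≤ ρ+r` and `ρ ≥ 0` then
`|λ−r| ≤ ρ ≤ λ+r`, and there is a constant `C = C(n) > 0` such that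
`h ≤ C r^{n−3} λ^{n−3}`, `h ≤ C ρ^{n−3} r^{(n−3)/2} λ^{(n−3)/2}` and `h ≤ C r^{n−3} ρ^{n−3}`. -/
theorem hKer_estimates (n : ℕ) (hn : 3 ≤ n) :
    (∀ r ρ lam : ℝ, 0 < r → 0 ≤ ρ → |ρ - r| ≤ lam → lam ≤ ρ + r →
      |lam - r| ≤ ρ ∧ ρ ≤ lam + r) ∧
    ∃ C : ℝ, 0 < C ∧ ∀ r ρ lam : ℝ, 0 < r → 0 ≤ ρ → |ρ - r| ≤ lam → lam ≤ ρ + r →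
      hKer n lam ρ r ≤ C * r ^ ((n : ℝ) - 3) * lam ^ ((n : ℝ) - 3) ∧
      hKer n lam ρ r ≤ C * ρ ^ ((n : ℝ) - 3) * r ^ (((n : ℝ) - 3) / 2) *
        lam ^ (((n : ℝ) - 3) / 2) ∧
      hKer n lam ρ r ≤ C * r ^ ((n : ℝ) - 3) * ρ ^ ((n : ℝ) - 3) := by
  have hs : 0 ≤ ((n : ℝ) - 3) / 2 := by
    have : (3 : ℝ) ≤ n := by exact_mod_cast hn
    linarith
  refine ⟨?_, (4 : ℝ) ^ (((n : ℝ) - 3) / 2), by positivity, ?_⟩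
  · intro r ρ lam hr hρ h1 h2
    rw [abs_le] at h1 ⊢
    refine ⟨⟨?_, ?_⟩, ?_⟩ <;> linarith [h1.1, h1.2]
  · intro r ρ lam hr hρ h1 h2
    have hl : 0 ≤ lam := (abs_nonneg _).trans h1
    have hA : 0 ≤ lam ^ 2 - (ρ - r) ^ 2 := by
      have := sq_le_sq' (by linarith [(abs_le.1 h1).1]) (abs_le.1 h1).2
      linarith
    have hB : 0 ≤ (ρ + r) ^ 2 - lam ^ 2 := by nlinarith
    have e : ∀ x : ℝ, 0 ≤ x → x ^ ((n : ℝ) - 3) = (x ^ 2) ^ (((n : ℝ) - 3) / 2) := by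
      intro x hx
      rw [← Real.rpow_natCast x 2, ← Real.rpow_mul hx]
      congr 1
      push_cast
      ring
    have b1 : (lam ^ 2 - (ρ - r) ^ 2) * ((ρ + r) ^ 2 - lam ^ 2) ≤ 4 * r ^ 2 * lam ^ 2 := by
      nlinarith [sq_nonneg (r ^ 2 + lam ^ 2 - ρ ^ 2)]
    have b3 : (lam ^ 2 - (ρ - r) ^ 2) * ((ρ + r) ^ 2 - lam ^ 2) ≤ 4 * r ^ 2 * ρ ^ 2 := by
      nlinarith [sq_nonneg (r ^ 2 + ρ ^ 2 - lam ^ 2)]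
    have b4 : (lam ^ 2 - (ρ - r) ^ 2) * ((ρ + r) ^ 2 - lam ^ 2) ≤ 4 * lam ^ 2 * ρ ^ 2 := by
      nlinarith [sq_nonneg (lam ^ 2 + ρ ^ 2 - r ^ 2)]
    have b2 : (lam ^ 2 - (ρ - r) ^ 2) * ((ρ + r) ^ 2 - lam ^ 2) ≤ 4 * ρ ^ 2 * r * lam := by
      rcases le_total r lam with h | h
      · have := mul_le_mul_of_nonneg_left h (by positivity : 0 ≤ 4 * ρ ^ 2 * r)
        nlinarith
      · have := mul_le_mul_of_nonneg_left h (by positivity : 0 ≤ 4 * ρ ^ 2 * lam)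
        nlinarith
    unfold hKer
    rw [← Real.mul_rpow hA hB, e r hr.le, e lam hl, e ρ hρ]
    refine ⟨?_, ?_, ?_⟩
    · rw [← Real.mul_rpow (by positivity) (by positivity),
        ← Real.mul_rpow (by positivity) (by positivity)]
      exact Real.rpow_le_rpow (mul_nonneg hA hB) b1 hs
    · rw [← Real.mul_rpow (by positivity) (by positivity),
        ← Real.mul_rpow (by positivity) (by positivity),
        ← Real.mul_rpow (by positivity) (by positivity)]
      exact Real.rpow_le_rpow (mul_nonneg hA hB) b2 hs
    · rw [← Real.mul_rpow (by positivity) (by positivity),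
        ← Real.mul_rpow (by positivity) (by positivity)]
      exact Real.rpow_le_rpow (mul_nonneg hA hB) b3 hs
end
end

section
/- Let n = 5, 7, 9, … (odd, n ≥ 5) and 1 < p < p₀(n), and assume (blowup_asm). Let u be a C⁰-solution of the integral equation u = ε u⁰ + L(|u|^p) on ℝⁿ × [0,T]. Then there exists ε₀ = ε₀(g,n,p,k) > 0 such that T cannot be taken with T > c ε^{−2p(p−1)/γ(p,n)} for any 0 < ε ≤ ε₀, where c > 0 is a constant independent of ε. -/
open MeasureTheory Real
open scoped Classical

noncomputable section

/-- Legendre polynomial of degree `k`, via the Rodrigues formula. -/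
def legendreP (k : ℕ) (z : ℝ) : ℝ :=
  (1 / (2 ^ k * (Nat.factorial k : ℝ))) * iteratedDeriv k (fun x : ℝ => (x ^ 2 - 1) ^ k) z

/-- Chebyshev polynomial of the first kind of degree `k`. -/
def chebT (k : ℕ) (z : ℝ) : ℝ := (Polynomial.Chebyshev.T ℝ (k : ℤ)).eval z

/-- `u` is a classical solution of the radial wave equation
`u_tt − ((n−1)/r) u_r − u_rr = 0` on `(0,∞) × [0,∞)` with data `u(r,0) = 0`, `u_t(r,0) = g(r)`. -/
def IsRadialWaveSol (n : ℕ) (g : ℝ → ℝ) (u : ℝ → ℝ → ℝ) : Prop :=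
  ContDiffOn ℝ 2 (fun pr : ℝ × ℝ => u pr.1 pr.2) (Set.Ioi 0 ×ˢ Set.Ici 0) ∧
  (∀ r ∈ Set.Ioi (0:ℝ), ∀ t ∈ Set.Ici (0:ℝ),
    iteratedDeriv 2 (fun s => u r s) t - (((n : ℝ) - 1) / r) * deriv (fun ρ => u ρ t) r -
      iteratedDeriv 2 (fun ρ => u ρ t) r = 0) ∧
  (∀ r ∈ Set.Ioi (0:ℝ), u r 0 = 0) ∧
  (∀ r ∈ Set.Ioi (0:ℝ), deriv (fun s => u r s) 0 = g r)


/-- surface measure (unnormalised Hausdorff) on the unit sphere -/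
def muS (n : ℕ) : Measure (Rn n) :=
  (Measure.hausdorffMeasure ((n : ℝ) - 1)).restrict (Metric.sphere (0 : Rn n) 1)

lemma finrank_orth {n : ℕ} (hn : 1 ≤ n) (v : Rn n) (hv : ‖v‖ = 1) :
    ((Module.finrank ℝ (Submodule.span ℝ {v})ᗮ : ℕ) : ℝ) = (n : ℝ) - 1 := by
  have h := Submodule.finrank_add_finrank_orthogonal (Submodule.span ℝ {v})
  have hv0 : v ≠ 0 := by
    intro h0; simp [h0] at hv
  rw [finrank_span_singleton hv0] at h
  have : Module.finrank ℝ (Rn n) = n := by simp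
  rw [this] at h
  have h2 : (1:ℝ) + ((Module.finrank ℝ (Submodule.span ℝ {v})ᗮ : ℕ) : ℝ) = n := by exact_mod_cast h
  linarith

lemma hemi_finite {n : ℕ} (hn : 1 ≤ n) (v : Rn n) (hv : ‖v‖ = 1) :
    Measure.hausdorffMeasure ((n : ℝ) - 1)
      (Metric.sphere (0 : Rn n) 1 ∩ {w | inner ℝ v w ≤ 0}) < ⊤ := by
  set V := (Submodule.span ℝ {v})ᗮ with hV
  have hd : (0:ℝ) ≤ (n:ℝ) - 1 := by
    have : (1:ℝ) ≤ n := by exact_mod_cast hn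
    linarith
  let f : V → Rn n := fun w => stereoInvFunAux v (w : Rn n)
  have hf : ContDiff ℝ 1 f := contDiff_stereoInvFunAux.comp V.subtypeL.contDiff
  obtain ⟨K, hK⟩ := (hf.locallyLipschitz.locallyLipschitzOn
    (s := Metric.closedBall (0:V) 2)).exists_lipschitzOnWith_of_compact (isCompact_closedBall _ _)
  have hsub : (Metric.sphere (0 : Rn n) 1 ∩ {w | inner ℝ v w ≤ 0}) ⊆ f '' Metric.closedBall (0:V) 2 := by
    rintro w ⟨hw, hw2⟩
    have hw1 : ‖w‖ = 1 := by simpa using hw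
    simp only [Set.mem_ofPred_eq] at hw2
    have hne : w ≠ v := by
      rintro rfl
      rw [real_inner_self_eq_norm_sq, hw1] at hw2
      norm_num at hw2
    refine ⟨stereoToFun v w, ?_, ?_⟩
    · rw [mem_closedBall_zero_iff, stereoToFun_apply, norm_smul]
      have h1 : ‖(Submodule.orthogonalProjectionOnto (Submodule.span ℝ {v})ᗮ) w‖ ≤ 1 := by
        rw [← hw1]; exact Submodule.norm_orthogonalProjectionOnto_apply_le _ _
      have h2 : ‖(2 / (1 - innerSL ℝ v w) : ℝ)‖ ≤ 2 := by
        have : (innerSL ℝ v w : ℝ) = inner ℝ v w := rfl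
        rw [this, Real.norm_eq_abs, abs_of_nonneg (by apply div_nonneg <;> linarith),
          div_le_iff₀ (by linarith)]
        linarith
      calc _ ≤ 2 * (1:ℝ) := mul_le_mul h2 h1 (norm_nonneg _) (by norm_num)
        _ = 2 := by norm_num
    · have := stereo_left_inv hv (x := ⟨w, hw⟩) hne
      exact congrArg Subtype.val this
  refine lt_of_le_of_lt (measure_mono hsub) ?_
  refine lt_of_le_of_lt (hK.hausdorffMeasure_image_le hd) ?_
  apply ENNReal.mul_lt_top
  · exact ENNReal.rpow_lt_top_of_nonneg hd ENNReal.coe_ne_top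
  · rw [← finrank_orth hn v hv]
    exact (isCompact_closedBall (0:V) 2).measure_lt_top

lemma sphere_finite {n : ℕ} (hn : 1 ≤ n) :
    Measure.hausdorffMeasure ((n : ℝ) - 1) (Metric.sphere (0 : Rn n) 1) < ⊤ := by
  let v : Rn n := EuclideanSpace.single ⟨0, hn⟩ 1
  have hv : ‖v‖ = 1 := by simp [v]
  have hsub : Metric.sphere (0 : Rn n) 1 ⊆
      (Metric.sphere (0 : Rn n) 1 ∩ {w | inner ℝ v w ≤ 0}) ∪
      (Metric.sphere (0 : Rn n) 1 ∩ {w | inner ℝ (-v) w ≤ 0}) := by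
    intro w hw
    rcases le_total (inner ℝ v w) 0 with h | h
    · exact Or.inl ⟨hw, h⟩
    · exact Or.inr ⟨hw, by simpa using h⟩
  refine lt_of_le_of_lt (measure_mono hsub) (lt_of_le_of_lt (measure_union_le _ _) ?_)
  exact ENNReal.add_lt_top.2 ⟨hemi_finite hn v hv, hemi_finite hn (-v) (by simpa using hv)⟩

lemma sphere_pos {n : ℕ} (hn : 1 ≤ n) :
    0 < Measure.hausdorffMeasure ((n : ℝ) - 1) (Metric.sphere (0 : Rn n) 1) := by
  let v : Rn n := EuclideanSpace.single ⟨0, hn⟩ 1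
  have hv : ‖v‖ = 1 := by simp [v]
  set V := (Submodule.span ℝ {v})ᗮ with hV
  have hd : (0:ℝ) ≤ (n:ℝ) - 1 := by
    have : (1:ℝ) ≤ n := by exact_mod_cast hn
    linarith
  have hL : LipschitzWith 1 (fun w : Rn n => V.orthogonalProjectionOnto w) := by
    apply LipschitzWith.of_dist_le_mul
    intro x y
    rw [dist_eq_norm, dist_eq_norm, ← map_sub]
    simpa using Submodule.norm_orthogonalProjectionOnto_apply_le V (x - y)
  have h1 := hL.hausdorffMeasure_image_le hd (Metric.sphere (0 : Rn n) 1)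
  simp only [ENNReal.coe_one, ENNReal.one_rpow, one_mul] at h1
  refine lt_of_lt_of_le ?_ h1
  have hsub : Metric.ball (0:V) 1 ⊆ (fun w : Rn n => V.orthogonalProjectionOnto w) '' (Metric.sphere (0 : Rn n) 1) := by
    intro w hw
    have hw1 : ‖w‖ < 1 := by simpa using hw
    have horth : inner ℝ (w : Rn n) v = 0 := by
      exact Submodule.mem_orthogonal_singleton_iff_inner_left.1 w.2
    refine ⟨(w : Rn n) + Real.sqrt (1 - ‖w‖^2) • v, ?_, ?_⟩
    · rw [mem_sphere_zero_iff_norm]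
      have : ‖(w : Rn n) + Real.sqrt (1 - ‖w‖^2) • v‖^2 = 1 := by
        rw [norm_add_sq_real, inner_smul_right, horth, norm_smul, hv]
        have : (0:ℝ) ≤ 1 - ‖w‖^2 := by nlinarith [norm_nonneg w]
        simp only [Real.norm_eq_abs, mul_one, sq_abs, Real.sq_sqrt this]
        simp
      nlinarith [norm_nonneg ((w : Rn n) + Real.sqrt (1 - ‖w‖^2) • v)]
    · simp only [map_add, map_smul]
      rw [Submodule.orthogonalProjectionOnto_mem_subspace_eq_self]
      have : V.orthogonalProjectionOnto v = 0 := by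
        exact Submodule.orthogonalProjection_orthogonalComplement_singleton_eq_zero v
      rw [this]; simp
  refine lt_of_lt_of_le ?_ (measure_mono hsub)
  rw [← finrank_orth hn v hv]
  exact Metric.measure_ball_pos _ _ one_pos

instance muS_finite (n : ℕ) [hn : Fact (1 ≤ n)] : IsFiniteMeasure (muS n) := by
  constructor
  simpa [muS] using sphere_finite hn.out

lemma muS_pos (n : ℕ) [hn : Fact (1 ≤ n)] : 0 < (muS n).real Set.univ := by
  rw [Measure.real, ENNReal.toReal_pos_iff]
  refine ⟨?_, measure_lt_top _ _⟩
  simpa [muS] using sphere_pos hn.out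

/-- rotation invariance -/
lemma muS_inv {n : ℕ} (e : Rn n ≃ₗᵢ[ℝ] Rn n) (F : Rn n → ℝ) :
    ∫ w, F (e w) ∂(muS n) = ∫ w, F w ∂(muS n) := by
  have h1 : MeasurePreserving e (Measure.hausdorffMeasure ((n : ℝ) - 1)) (Measure.hausdorffMeasure ((n : ℝ) - 1)) :=
    e.toIsometryEquiv.measurePreserving_hausdorffMeasure _
  have h2 := h1.restrict_preimage (s := Metric.sphere (0 : Rn n) 1) Metric.isClosed_sphere.measurableSet
  have h3 : e ⁻¹' (Metric.sphere (0 : Rn n) 1) = Metric.sphere (0 : Rn n) 1 := by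
    ext w; simp
  rw [h3] at h2
  exact h2.integral_comp e.toHomeomorph.measurableEmbedding F

lemma muS_inner_inv {n : ℕ} (v w : Rn n) (h : ‖v‖ = ‖w‖) (F : ℝ → ℝ) :
    ∫ y, F (inner ℝ v y) ∂(muS n) = ∫ y, F (inner ℝ w y) ∂(muS n) := by
  let e := Submodule.reflection (Submodule.span ℝ {v - w})ᗮ
  have he : e v = w := Submodule.reflection_sub h
  rw [← muS_inv e (fun y => F (inner ℝ w y))]
  congr 1; ext y
  rw [← he, LinearIsometryEquiv.inner_map_map]

lemma muS_ae_norm (n : ℕ) : ∀ᵐ w ∂(muS n), ‖w‖ = 1 := by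
  have := ae_restrict_mem (μ := (Measure.hausdorffMeasure ((n : ℝ) - 1) : Measure (Rn n)))
    (s := Metric.sphere (0 : Rn n) 1) Metric.isClosed_sphere.measurableSet
  filter_upwards [this] with w hw using by simpa using hw

lemma muS_integrable {n : ℕ} [hn : Fact (1 ≤ n)] {F : Rn n → ℝ} (hF : Continuous F) :
    Integrable F (muS n) := by
  have := hF.continuousOn.integrableOn_compact (μ := muS n) (isCompact_sphere (0 : Rn n) 1)
  rw [IntegrableOn, muS, Measure.restrict_restrict Metric.isClosed_sphere.measurableSet, Set.inter_self] at this
  exact this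

def MomS (n : ℕ) [hn : Fact (1 ≤ n)] (N : ℕ) : ℝ := ∫ w, (w ⟨0, hn.out⟩) ^ N ∂(muS n)

lemma MomS_odd (n : ℕ) [hn : Fact (1 ≤ n)] (N : ℕ) (hN : Odd N) : MomS n N = 0 := by
  have h := muS_inner_inv (EuclideanSpace.single (⟨0, hn.out⟩ : Fin n) (1:ℝ))
    (-(EuclideanSpace.single (⟨0, hn.out⟩ : Fin n) (1:ℝ))) (by simp) (fun z => z ^ N)
  simp only [inner_neg_left, EuclideanSpace.inner_single_left, map_one, one_mul, hN.neg_pow] at h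
  rw [integral_neg] at h
  unfold MomS
  linarith

lemma mom_mixed (n : ℕ) [hn : Fact (1 ≤ n)] (j : ℕ) (hj : 1 ≤ j) (i : Fin n) (hi : i ≠ ⟨0, hn.out⟩) :
    (2 * (j:ℝ) - 1) * ∫ w, (w ⟨0, hn.out⟩) ^ (2 * j - 2) * (w i) ^ 2 ∂(muS n) = MomS n (2 * j) := by
  set o : Fin n := ⟨0, hn.out⟩ with ho
  have key : ∀ a : ℝ, ∫ w, (a * w i + w o) ^ (2 * j) ∂(muS n) = (1 + a ^ 2) ^ j * MomS n (2 * j) := by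
    intro a
    have h := muS_inner_inv (EuclideanSpace.single o (1:ℝ) + a • EuclideanSpace.single i (1:ℝ))
      (Real.sqrt (1 + a ^ 2) • EuclideanSpace.single o (1:ℝ)) ?_ (fun z => z ^ (2 * j))
    · simp only [inner_add_left, inner_smul_left, EuclideanSpace.inner_single_left, map_one, one_mul, mul_pow] at h
      rw [integral_const_mul] at h
      simp only [RCLike.conj_to_real] at h
      rw [pow_mul (√(1 + a^2)), Real.sq_sqrt (by positivity)] at h
      simp only [add_comm (a * _)]
      exact h
    · have h1 : ‖EuclideanSpace.single o (1:ℝ) + a • EuclideanSpace.single i (1:ℝ)‖ ^ 2 = 1 + a ^ 2 := by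
        rw [norm_add_sq_real, inner_smul_right, norm_smul]
        simp [EuclideanSpace.inner_single_left, hi.symm]
      rw [norm_smul]
      simp only [EuclideanSpace.norm_single, norm_one, mul_one, Real.norm_eq_abs,
        abs_of_nonneg (Real.sqrt_nonneg _)]
      rw [← h1, Real.sqrt_sq (norm_nonneg _)]
  let E : ℕ → ℝ := fun l => ∫ w, (w i) ^ l * (w o) ^ (2 * j - l) * ((2 * j).choose l : ℝ) ∂(muS n)
  let P : Polynomial ℝ := ∑ l ∈ Finset.range (2 * j + 1), Polynomial.C (E l) * Polynomial.X ^ l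
  let Q : Polynomial ℝ := Polynomial.C (MomS n (2 * j)) * Polynomial.expand ℝ 2 ((1 + Polynomial.X) ^ j)
  have hPQ : P = Q := by
    apply Polynomial.funext
    intro a
    have h1 : Q.eval a = (1 + a ^ 2) ^ j * MomS n (2 * j) := by
      simp [Q, Polynomial.expand_eval, mul_comm]
    rw [h1, ← key a]
    simp only [add_pow]
    rw [integral_finsetSum]
    · simp only [P, Polynomial.eval_finsetSum, Polynomial.eval_mul, Polynomial.eval_C, Polynomial.eval_pow, Polynomial.eval_X]
      apply Finset.sum_congr rfl
      intro l hl
      rw [mul_comm, ← integral_const_mul]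
      congr 1; ext w; ring
    · intro l hl
      apply muS_integrable
      fun_prop
  have h2 := congrArg (fun q => Polynomial.coeff q 2) hPQ
  have hP : P.coeff 2 = E 2 := by
    simp only [P, Polynomial.finset_sum_coeff, Polynomial.coeff_C_mul_X_pow]
    rw [Finset.sum_ite_eq]
    simp
    omega
  have hQ : Q.coeff 2 = MomS n (2 * j) * j := by
    simp only [Q, Polynomial.coeff_C_mul]
    have := Polynomial.coeff_expand_mul (R := ℝ) (p := 2) (by norm_num) ((1 + Polynomial.X) ^ j) 1
    simp only [one_mul] at this
    rw [this, Polynomial.coeff_one_add_X_pow]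
    simp
  simp only [hP, hQ, E] at h2
  rw [integral_mul_const] at h2
  have hc : (((2 * j).choose 2 : ℕ) : ℝ) = j * (2 * j - 1) := by
    rw [Nat.cast_choose_two]; push_cast; ring
  rw [hc] at h2
  have hj0 : (j:ℝ) ≠ 0 := by positivity
  have h3 : ∫ w, (w o) ^ (2 * j - 2) * (w i) ^ 2 ∂(muS n) = ∫ w, (w i) ^ 2 * (w o) ^ (2 * j - 2) ∂(muS n) := by
    congr 1; ext w; ring
  rw [h3]
  apply mul_left_cancel₀ hj0
  linarith

lemma MomS_rec (n : ℕ) [hn : Fact (1 ≤ n)] (j : ℕ) (hj : 1 ≤ j) :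
    (2 * (j:ℝ) - 1) * MomS n (2 * j - 2) = (2 * (j:ℝ) - 1 + ((n:ℝ) - 1)) * MomS n (2 * j) := by
  set o : Fin n := ⟨0, hn.out⟩ with ho
  have h1 : MomS n (2 * j - 2) = ∑ i, ∫ w, (w o) ^ (2 * j - 2) * (w i) ^ 2 ∂(muS n) := by
    rw [← integral_finsetSum]
    · unfold MomS
      apply integral_congr_ae
      filter_upwards [muS_ae_norm n] with w hw
      rw [← Finset.mul_sum]
      have : ∑ i, (w i) ^ 2 = 1 := by
        have := EuclideanSpace.norm_sq_eq w
        rw [hw] at this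
        simpa using this.symm
      rw [this, mul_one]
    · intro i _
      apply muS_integrable
      fun_prop
  have h2 : MomS n (2 * j) = ∫ w, (w o) ^ (2 * j - 2) * (w o) ^ 2 ∂(muS n) := by
    unfold MomS
    congr 1; ext w
    rw [← pow_add]; congr 1; omega
  rw [h1, Finset.mul_sum, ← Finset.add_sum_erase _ _ (Finset.mem_univ o), ← h2,
    Finset.sum_congr rfl (fun i hi => mom_mixed n j hj i (Finset.ne_of_mem_erase hi))]
  rw [Finset.sum_const, Finset.card_erase_of_mem (Finset.mem_univ o), Finset.card_univ, Fintype.card_fin,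
    nsmul_eq_mul, Nat.cast_sub hn.out]
  push_cast; ring

def WMom (m N : ℕ) : ℝ := ∫ z in (-1:ℝ)..1, z ^ N * (1 - z ^ 2) ^ (m - 1)

lemma WMom_zero_pos (m : ℕ) : 0 < WMom m 0 := by
  unfold WMom
  apply intervalIntegral.intervalIntegral_pos_of_pos_on
  · apply Continuous.intervalIntegrable; fun_prop
  · intro x hx
    have : 0 < 1 - x ^ 2 := by nlinarith [hx.1, hx.2]
    positivity
  · norm_num

lemma WMom_odd (m N : ℕ) (hN : Odd N) : WMom m N = 0 := by
  have h := intervalIntegral.integral_comp_neg (a := -1) (b := 1) (fun z : ℝ => z ^ N * (1 - z ^ 2) ^ (m - 1))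
  simp only [neg_neg, hN.neg_pow, even_two.neg_pow, neg_mul] at h
  rw [intervalIntegral.integral_neg] at h
  unfold WMom; linarith

lemma WMom_rec (m : ℕ) (hm : 1 ≤ m) (j : ℕ) (hj : 1 ≤ j) :
    (2 * (j:ℝ) - 1) * WMom m (2 * j - 2) = (2 * (j:ℝ) - 1 + 2 * m) * WMom m (2 * j) := by
  obtain ⟨m, rfl⟩ := Nat.exists_eq_add_of_le' hm
  obtain ⟨j, rfl⟩ := Nat.exists_eq_add_of_le' hj
  have hd : ∀ z : ℝ, HasDerivAt (fun z : ℝ => z ^ (2 * j + 1) * (1 - z ^ 2) ^ (m + 1))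
      ((2 * j + 1) * (z ^ (2 * j) * (1 - z ^ 2) ^ m) - (2 * j + 1 + 2 * (m + 1)) * (z ^ (2 * j + 2) * (1 - z ^ 2) ^ m)) z := by
    intro z
    have h1 := (hasDerivAt_pow (2 * j + 1) z).mul (((hasDerivAt_pow 2 z).const_sub 1).pow (m + 1))
    refine h1.congr_deriv ?_
    simp
    ring
  have h := intervalIntegral.integral_eq_sub_of_hasDerivAt (a := -1) (b := 1) (fun z _ => hd z)
    (by apply Continuous.intervalIntegrable; fun_prop)
  rw [intervalIntegral.integral_sub, intervalIntegral.integral_const_mul, intervalIntegral.integral_const_mul] at h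
  · simp only [WMom, Nat.add_sub_cancel]
    have e1 : 2 * (j + 1) - 2 = 2 * j := by omega
    have e2 : 2 * (j + 1) = 2 * j + 2 := by omega
    rw [e1, e2]
    push_cast
    norm_num at h
    linarith
  · apply Continuous.intervalIntegrable; fun_prop
  · apply Continuous.intervalIntegrable; fun_prop

lemma Mom_eq (n m : ℕ) [hn : Fact (1 ≤ n)] (hnm : n = 2 * m + 1) (hm : 1 ≤ m) (N : ℕ) :
    MomS n N = MomS n 0 / WMom m 0 * WMom m N := by
  rcases Nat.even_or_odd' N with ⟨j, rfl | rfl⟩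
  · induction j with
    | zero => have := (WMom_zero_pos m).ne'; simp; field_simp
    | succ j ih =>
      have h1 := MomS_rec n (j + 1) (by omega)
      have h2 := WMom_rec m hm (j + 1) (by omega)
      have e1 : 2 * (j + 1) - 2 = 2 * j := by omega
      rw [e1] at h1 h2
      have e3 : (n:ℝ) - 1 = 2 * m := by rw [hnm]; push_cast; ring
      rw [e3, ih] at h1
      have hne : (2 * ((j+1:ℕ):ℝ) - 1 + 2 * m) ≠ 0 := by push_cast; ring_nf; positivity
      apply mul_left_cancel₀ hne
      rw [← h1]
      linear_combination (MomS n 0 / WMom m 0) * h2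
  · rw [MomS_odd n _ (by simp), WMom_odd m (2 * j + 1) (by simp), mul_zero]

def kapS (n m : ℕ) : ℝ := (muS n).real Set.univ / WMom m 0

lemma kapS_pos (n m : ℕ) [hn : Fact (1 ≤ n)] : 0 < kapS n m := div_pos (muS_pos n) (WMom_zero_pos m)

lemma radial_poly (n m : ℕ) [hn : Fact (1 ≤ n)] (hnm : n = 2 * m + 1) (hm : 1 ≤ m) (q : Polynomial ℝ) :
    ∫ w, q.eval (w ⟨0, hn.out⟩) ∂(muS n) = kapS n m * ∫ z in (-1:ℝ)..1, q.eval z * (1 - z ^ 2) ^ (m - 1) := by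
  have h0 : MomS n 0 = (muS n).real Set.univ := by simp [MomS]
  simp only [Polynomial.eval_eq_sum_range, Finset.sum_mul]
  rw [integral_finsetSum, intervalIntegral.integral_finsetSum, Finset.mul_sum]
  · apply Finset.sum_congr rfl
    intro i _
    rw [integral_const_mul]
    simp only [mul_assoc]
    rw [intervalIntegral.integral_const_mul]
    have := Mom_eq n m hnm hm i
    unfold MomS WMom at this
    rw [this, kapS, ← h0]
    unfold MomS WMom
    ring
  · intro i _
    apply Continuous.intervalIntegrable; fun_prop
  · intro i _
    apply muS_integrable; fun_prop

lemma radial_cont (n m : ℕ) [hn : Fact (1 ≤ n)] (hnm : n = 2 * m + 1) (hm : 1 ≤ m) (f : ℝ → ℝ) (hf : Continuous f)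
    (v : Rn n) (hv : ‖v‖ = 1) :
    ∫ w, f (inner ℝ v w) ∂(muS n) = kapS n m * ∫ z in (-1:ℝ)..1, f z * (1 - z ^ 2) ^ (m - 1) := by
  rw [muS_inner_inv v (EuclideanSpace.single (⟨0, hn.out⟩ : Fin n) (1:ℝ)) (by simp [hv])]
  simp only [EuclideanSpace.inner_single_left, map_one, one_mul]
  set A := ∫ w, f (w ⟨0, hn.out⟩) ∂(muS n) with hA
  set B := ∫ z in (-1:ℝ)..1, f z * (1 - z ^ 2) ^ (m - 1) with hB
  have hk := kapS_pos n m
  have hbound : ∀ δ > 0, |A - kapS n m * B| ≤ δ * (2 * (muS n).real Set.univ) := by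
    intro δ hδ
    obtain ⟨q, hq⟩ := exists_polynomial_near_of_continuousOn (-1) 1 f hf.continuousOn δ hδ
    have hqr := radial_poly n m hnm hm q
    have h1 : |A - ∫ w, q.eval (w ⟨0, hn.out⟩) ∂(muS n)| ≤ δ * (muS n).real Set.univ := by
      rw [hA, ← integral_sub (muS_integrable (by fun_prop)) (muS_integrable (by fun_prop))]
      rw [← Real.norm_eq_abs]
      apply norm_integral_le_of_norm_le_const
      filter_upwards [muS_ae_norm n] with w hw
      have h2 : |w ⟨0, hn.out⟩| ≤ 1 := by
        rw [← hw]; exact PiLp.norm_apply_le w _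
      have := hq (w ⟨0, hn.out⟩) (abs_le.1 h2)
      rw [Real.norm_eq_abs, abs_sub_comm]; exact this.le
    have h2 : |B - ∫ z in (-1:ℝ)..1, q.eval z * (1 - z ^ 2) ^ (m - 1)| ≤ δ * WMom m 0 := by
      rw [hB, ← intervalIntegral.integral_sub (by apply Continuous.intervalIntegrable; fun_prop)
        (by apply Continuous.intervalIntegrable; fun_prop), WMom, ← intervalIntegral.integral_const_mul,
        ← Real.norm_eq_abs]
      apply intervalIntegral.norm_integral_le_of_norm_le (by norm_num)
      · refine Filter.Eventually.of_forall ?_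
        intro z hz
        have hz1 : z ∈ Set.Icc (-1:ℝ) 1 := ⟨hz.1.le, hz.2⟩
        have h3 : 0 ≤ 1 - z ^ 2 := by nlinarith [hz1.1, hz1.2]
        rw [← sub_mul, norm_mul, norm_pow, Real.norm_eq_abs, Real.norm_eq_abs, abs_of_nonneg h3, pow_zero, one_mul]
        apply mul_le_mul_of_nonneg_right _ (by positivity)
        rw [abs_sub_comm]; exact (hq z hz1).le
      · apply Continuous.intervalIntegrable; fun_prop
    have h3 : kapS n m * (δ * WMom m 0) = δ * (muS n).real Set.univ := by
      have := (WMom_zero_pos m).ne'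
      unfold kapS; field_simp
    have h4 : A - kapS n m * B = (A - ∫ w, q.eval (w ⟨0, hn.out⟩) ∂(muS n)) -
        kapS n m * (B - ∫ z in (-1:ℝ)..1, q.eval z * (1 - z ^ 2) ^ (m - 1)) := by
      rw [hqr]; ring
    rw [h4]
    refine (abs_sub _ _).trans ?_
    rw [abs_mul, abs_of_pos hk]
    have := mul_le_mul_of_nonneg_left h2 hk.le
    linarith
  have hμ := muS_pos n
  by_contra hne
  have hpos : 0 < |A - kapS n m * B| := abs_pos.2 (sub_ne_zero.2 hne)
  have := hbound (|A - kapS n m * B| / (4 * (muS n).real Set.univ)) (by positivity)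
  rw [div_mul_eq_mul_div, le_div_iff₀ (by positivity)] at this
  nlinarith

/-- unnormalised Legendre polynomial -/
def LB (k : ℕ) : Polynomial ℝ := Polynomial.derivative^[k] ((Polynomial.X ^ 2 - 1) ^ k)

lemma iteratedDeriv_poly (q : Polynomial ℝ) (k : ℕ) :
    iteratedDeriv k (fun x => q.eval x) = fun x => (Polynomial.derivative^[k] q).eval x := by
  induction k with
  | zero => simp
  | succ k ih =>
    rw [iteratedDeriv_succ, ih]
    ext x
    rw [Polynomial.deriv, Function.iterate_succ_apply']

lemma legendreP_eq (k : ℕ) (z : ℝ) :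
    legendreP k z = (1 / (2 ^ k * (Nat.factorial k : ℝ))) * (LB k).eval z := by
  unfold legendreP LB
  rw [← congrFun (iteratedDeriv_poly ((Polynomial.X ^ 2 - 1) ^ k) k) z]
  simp

lemma LB_rec (N : ℕ) :
    LB (N + 1) = 2 * (Polynomial.X ^ 2 - 1) * Polynomial.derivative (LB N)
      + 2 * ((N : Polynomial ℝ) + 1) * Polynomial.X * LB N := by
  set v : Polynomial ℝ := (Polynomial.X ^ 2 - 1) ^ N with hv
  have hX : ∀ (k : ℕ) (q : Polynomial ℝ), Polynomial.derivative^[k] (q * Polynomial.X) =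
      Polynomial.derivative^[k] q * Polynomial.X + (k : Polynomial ℝ) * Polynomial.derivative^[k - 1] q := by
    intro k q
    have := Polynomial.iterate_derivative_mul_X (n := k) q
    simpa [nsmul_eq_mul] using this
  have h1 : LB (N + 1) = Polynomial.derivative^[N + 1] (v * Polynomial.X * Polynomial.X) - Polynomial.derivative^[N + 1] v := by
    rw [← Polynomial.iterate_derivative_sub, LB]
    congr 1
    rw [hv]; ring
  have h2 : LB (N + 1) = 2 * ((N : Polynomial ℝ) + 1) * Polynomial.derivative^[N] (v * Polynomial.X) := by
    rw [LB, Function.iterate_succ_apply, Polynomial.derivative_pow]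
    have c2 : (Polynomial.C (2:ℝ)) = 2 := rfl
    have e : (Polynomial.C ((N + 1 : ℕ) : ℝ) * (Polynomial.X ^ 2 - 1) ^ (N + 1 - 1) *
        Polynomial.derivative (Polynomial.X ^ 2 - 1 : Polynomial ℝ)) =
        Polynomial.C (2 * (N + 1) : ℝ) * (v * Polynomial.X) := by
      simp [hv, c2]; ring
    rw [e, Polynomial.iterate_derivative_C_mul]
    simp [c2]
  rw [hX, Nat.add_sub_cancel, hX (N + 1)] at h1
  have h3 : Polynomial.derivative (LB N) = Polynomial.derivative^[N + 1] v := by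
    rw [LB, Function.iterate_succ_apply']
  rw [h3]
  have h4 : LB N = Polynomial.derivative^[N] v := rfl
  rw [h4]
  rw [Nat.add_sub_cancel] at h1
  push_cast at h1
  linear_combination 2 * h1 - h2

lemma LB_pos (N : ℕ) (z0 : ℝ) (hz0 : 0 < z0) (hz1 : z0 < 1)
    (h : ∀ z, z0 < z → 1 / 2 < legendreP (N + 1) z) (z : ℝ) (hz : z0 < z) (hz' : z ≤ 1) :
    0 < (LB N).eval z := by
  have hR : ∀ z, z0 < z → 0 < (LB (N + 1)).eval z := by
    intro z hz
    have h1 := h z hz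
    rw [legendreP_eq] at h1
    by_contra hcon
    push Not at hcon
    have : 1 / (2 ^ (N + 1) * (Nat.factorial (N + 1) : ℝ)) * (LB (N + 1)).eval z ≤ 0 :=
      mul_nonpos_of_nonneg_of_nonpos (by positivity) hcon
    linarith
  have hrec : ∀ z, (LB (N + 1)).eval z = 2 * (z ^ 2 - 1) * (Polynomial.derivative (LB N)).eval z
      + 2 * (N + 1) * z * (LB N).eval z := by
    intro z
    rw [LB_rec]; simp
  by_contra hcon
  push Not at hcon
  let S : Set ℝ := Set.Icc z 1 ∩ {y | (LB N).eval y ≤ 0}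
  have hS : IsCompact S := isCompact_Icc.inter_right
    (isClosed_le (by fun_prop) continuous_const)
  obtain ⟨y, hyS, hymax⟩ := hS.exists_isGreatest ⟨z, ⟨le_refl _, hz'⟩, hcon⟩
  have hy0 : z0 < y := lt_of_lt_of_le hz hyS.1.1
  have hyB : (LB N).eval y ≤ 0 := hyS.2
  have hRy := hR y hy0
  rw [hrec] at hRy
  have hprod : 2 * ((N:ℝ) + 1) * y * (LB N).eval y ≤ 0 :=
    mul_nonpos_of_nonneg_of_nonpos (by have := hz0.trans hy0; positivity) hyB
  have hy1 : y < 1 := by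
    rcases lt_or_eq_of_le hyS.1.2 with h1 | h1
    · exact h1
    · subst h1
      norm_num at hRy hprod
      linarith
  have hd : (Polynomial.derivative (LB N)).eval y < 0 := by
    by_contra hc
    push Not at hc
    have : y ^ 2 - 1 ≤ 0 := by nlinarith
    have := mul_nonpos_of_nonpos_of_nonneg (by linarith : 2 * (y ^ 2 - 1) ≤ 0) hc
    linarith
  have hder := (LB N).hasDerivAt y
  have hev := hder.hasDerivWithinAt (s := Set.Ioi y)
  have hsl := hev.limsup_slope_le' (by simp) hd
  have hmem : Set.Ioo y 1 ∈ nhdsWithin y (Set.Ioi y) := Ioo_mem_nhdsGT hy1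
  obtain ⟨w, hw1, hw2⟩ := (hsl.and hmem).exists
  rw [slope_def_field, div_neg_iff] at hw1
  have hwlt : (LB N).eval w < (LB N).eval y := by
    rcases hw1 with ⟨_, h2⟩ | ⟨h1, _⟩
    · linarith [hw2.1]
    · linarith
  have : w ≤ y := hymax ⟨⟨hyS.1.1.trans hw2.1.le, hw2.2.le⟩, by
    show (LB N).eval w ≤ 0
    linarith⟩
  linarith [hw2.1]

lemma LB_lower (N : ℕ) (z0 z1 : ℝ) (hz0 : 0 < z0) (hz01 : z0 < z1) (hz1 : z1 < 1)
    (h : ∀ z, z0 < z → 1 / 2 < legendreP (N + 1) z) :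
    ∃ δ > 0, ∀ z ∈ Set.Icc z1 1, δ ≤ (LB N).eval z := by
  obtain ⟨y, hy, hmin⟩ := (isCompact_Icc (a := z1) (b := (1:ℝ))).exists_isMinOn ⟨z1, le_refl _, hz1.le⟩
    (f := fun z => (LB N).eval z) (by fun_prop)
  exact ⟨(LB N).eval y, LB_pos N z0 hz0 (hz01.trans hz1) h y (lt_of_lt_of_le hz01 hy.1) hy.2, fun z hz => hmin hz⟩

lemma uIcc_sub_Ioi {a b : ℝ} (ha : 0 < a) (hb : 0 < b) : Set.uIcc a b ⊆ Set.Ioi 0 := by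
  intro x hx
  exact lt_of_lt_of_le (lt_min ha hb) hx.1

lemma deriv_I_pow (r k : ℝ) (hk : 0 < k) (α β : ℝ → ℝ)
    (hα : ContinuousOn α (Set.Ioi 0)) (hβ : ContinuousOn β (Set.Ioi 0)) (N : ℕ) :
    ∀ (w : ℝ → ℝ), ContinuousOn w (Set.Ioi 0) → ∀ s, 0 < r - s →
    HasDerivAt (fun s => ∫ l in (r - s)..k, w l * (α l + β l * s ^ 2) ^ N)
      (w (r - s) * (α (r - s) + β (r - s) * s ^ 2) ^ N +
        ∫ l in (r - s)..k, w l * (N * (α l + β l * s ^ 2) ^ (N - 1) * (2 * β l * s))) s := by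
  have hint : ∀ (f : ℝ → ℝ), ContinuousOn f (Set.Ioi 0) → ∀ s, 0 < r - s →
      IntervalIntegrable f volume (r - s) k := fun f hf s hs =>
    (hf.mono (uIcc_sub_Ioi hs hk)).intervalIntegrable
  induction N with
  | zero =>
    intro w hw s hs
    have h1 : HasDerivAt (fun u => ∫ x in u..k, w x) (-w (r - s)) (r - s) := by
      apply intervalIntegral.integral_hasDerivAt_left (hint w hw s hs)
      · exact hw.stronglyMeasurableAtFilter isOpen_Ioi _ hs
      · exact hw.continuousAt (isOpen_Ioi.mem_nhds hs)
    have h2 := h1.comp s ((hasDerivAt_id s).const_sub r)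
    simpa [Function.comp_def] using h2
  | succ N ih =>
    intro w hw s hs
    have h1 := ih (fun l => w l * α l) (hw.mul hα) s hs
    have h2 := ih (fun l => w l * β l) (hw.mul hβ) s hs
    have h3 := h1.add ((hasDerivAt_pow 2 s).mul h2)
    have hev : (fun s => ∫ l in (r - s)..k, w l * (α l + β l * s ^ 2) ^ (N + 1)) =ᶠ[nhds s]
        (fun s => (∫ l in (r - s)..k, w l * α l * (α l + β l * s ^ 2) ^ N) +
          s ^ 2 * ∫ l in (r - s)..k, w l * β l * (α l + β l * s ^ 2) ^ N) := by
      have : {u | 0 < r - u} ∈ nhds s := (isOpen_lt continuous_const (by fun_prop)).mem_nhds hs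
      filter_upwards [this] with u hu
      rw [← intervalIntegral.integral_const_mul, ← intervalIntegral.integral_add]
      · congr 1; ext l; ring
      · exact hint _ (by fun_prop) u hu
      · exact hint _ (by fun_prop) u hu
    refine (h3.congr_of_eventuallyEq hev).congr_deriv ?_
    have e1 : ∫ l in (r - s)..k, w l * (((N + 1 : ℕ):ℝ) * (α l + β l * s ^ 2) ^ (N + 1 - 1) * (2 * β l * s)) =
        (∫ l in (r - s)..k, w l * α l * (N * (α l + β l * s ^ 2) ^ (N - 1) * (2 * β l * s))) +
        (2 * s * ∫ l in (r - s)..k, w l * β l * (α l + β l * s ^ 2) ^ N) +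
        s ^ 2 * ∫ l in (r - s)..k, w l * β l * (N * (α l + β l * s ^ 2) ^ (N - 1) * (2 * β l * s)) := by
      rw [← intervalIntegral.integral_const_mul, ← intervalIntegral.integral_const_mul,
        ← intervalIntegral.integral_add, ← intervalIntegral.integral_add]
      · congr 1; ext l
        rcases Nat.eq_zero_or_pos N with rfl | hN
        · simp; ring
        · obtain ⟨M, rfl⟩ := Nat.exists_eq_add_of_le' hN
          simp only [Nat.add_sub_cancel]
          push_cast; ring
      · exact hint _ (by fun_prop) s hs
      · exact hint _ (by fun_prop) s hs
      · exact hint _ (by fun_prop) s hs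
      · exact hint _ (by fun_prop) s hs
    rw [e1]
    push_cast
    ring

lemma deriv_I (r k : ℝ) (hk : 0 < k) (α β w : ℝ → ℝ)
    (hα : ContinuousOn α (Set.Ioi 0)) (hβ : ContinuousOn β (Set.Ioi 0)) (hw : ContinuousOn w (Set.Ioi 0))
    (q : Polynomial ℝ) (s : ℝ) (hs : 0 < r - s) :
    HasDerivAt (fun s => ∫ l in (r - s)..k, w l * q.eval (α l + β l * s ^ 2))
      (w (r - s) * q.eval (α (r - s) + β (r - s) * s ^ 2) +
        ∫ l in (r - s)..k, w l * (q.derivative.eval (α l + β l * s ^ 2) * (2 * β l * s))) s := by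
  have hint : ∀ (f : ℝ → ℝ), ContinuousOn f (Set.Ioi 0) → ∀ s, 0 < r - s →
      IntervalIntegrable f volume (r - s) k := fun f hf s hs =>
    (hf.mono (uIcc_sub_Ioi hs hk)).intervalIntegrable
  induction q using Polynomial.induction_on' with
  | add p q hp hq =>
    have hev : (fun s => ∫ l in (r - s)..k, w l * (p + q).eval (α l + β l * s ^ 2)) =ᶠ[nhds s]
        (fun s => (∫ l in (r - s)..k, w l * p.eval (α l + β l * s ^ 2)) +
          ∫ l in (r - s)..k, w l * q.eval (α l + β l * s ^ 2)) := by
      have : {u | 0 < r - u} ∈ nhds s := (isOpen_lt continuous_const (by fun_prop)).mem_nhds hs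
      filter_upwards [this] with u hu
      rw [← intervalIntegral.integral_add]
      · congr 1; ext l; simp; ring
      · exact hint _ (by fun_prop) u hu
      · exact hint _ (by fun_prop) u hu
    refine ((hp.add hq).congr_of_eventuallyEq hev).congr_deriv ?_
    have e1 : ∫ l in (r - s)..k, w l * ((p + q).derivative.eval (α l + β l * s ^ 2) * (2 * β l * s)) =
      (∫ l in (r - s)..k, w l * (p.derivative.eval (α l + β l * s ^ 2) * (2 * β l * s))) +
      ∫ l in (r - s)..k, w l * (q.derivative.eval (α l + β l * s ^ 2) * (2 * β l * s)) := by
      rw [← intervalIntegral.integral_add]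
      · congr 1; ext l; simp; ring
      · exact hint _ (by fun_prop) s hs
      · exact hint _ (by fun_prop) s hs
    rw [e1]; simp; ring
  | monomial N a =>
    have h := (deriv_I_pow r k hk α β hα hβ N (fun l => w l * a) (by fun_prop) s hs)
    convert h using 1
    · ext u; congr 1; ext l; simp; ring
    · congr 1
      · simp; ring
      · congr 1; ext l; simp [Polynomial.derivative_monomial]; ring

lemma Mop_eq (n : ℕ) (hodd : n % 2 = 1) (φ : Rn n → ℝ) (x : Rn n) (s : ℝ) :
    Mop n φ x s = (1 / omegaN n) * ∫ w, φ (x + s • w) ∂(muS n) := by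
  simp [Mop, hodd, muS]

lemma omegaN_pos (n : ℕ) (hn : 1 ≤ n) : 0 < omegaN n := by
  unfold omegaN
  have : (0:ℝ) < n := by exact_mod_cast hn
  have := Real.Gamma_pos_of_pos (half_pos this)
  positivity

lemma DtIter_congr (j : ℕ) (F G : ℝ → ℝ) (t : ℝ) (h : F =ᶠ[nhds t] G) :
    DtIter j F =ᶠ[nhds t] DtIter j G := by
  induction j with
  | zero => exact h
  | succ j ih =>
    have := ih.deriv
    filter_upwards [this] with s hs
    simp only [DtIter, hs]

lemma DtIter_zero (j : ℕ) : DtIter j (fun _ => 0) = fun _ => 0 := by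
  induction j with
  | zero => rfl
  | succ j ih => simp [DtIter, ih]

lemma Rop_huygens (n : ℕ) (hodd : n % 2 = 1) (g : ℝ → ℝ) (k : ℝ)
    (hsupp : ∀ s : ℝ, k < s → g s = 0) (hk : 0 < k) (x : Rn n) (t : ℝ) (ht : k < t - ‖x‖) :
    Rop n (fun y => g ‖y‖) x t = 0 := by
  have hev : (fun s => s ^ (2 * (n / 2) - 1) * Mop n (fun y => g ‖y‖) x s) =ᶠ[nhds t] fun _ => 0 := by
    have : {s | k < s - ‖x‖} ∈ nhds t := (isOpen_lt continuous_const (by fun_prop)).mem_nhds ht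
    filter_upwards [this] with s hs
    have hs' : k < s - ‖x‖ := hs
    rw [Mop_eq n hodd]
    have : ∫ w, g ‖x + s • w‖ ∂(muS n) = 0 := by
      apply integral_eq_zero_of_ae
      filter_upwards [muS_ae_norm n] with w hw
      apply hsupp
      have h1 : ‖s • w‖ = s := by
        rw [norm_smul, hw, mul_one, Real.norm_eq_abs, abs_of_pos]
        linarith [norm_nonneg x]
      have h2 : ‖s • w‖ ≤ ‖x + s • w‖ + ‖x‖ := by
        have := norm_sub_le (x + s • w) x
        simpa using this
      linarith
    rw [this]; simp
  have := (DtIter_congr (n / 2 - 1) _ _ t hev).self_of_nhds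
  rw [DtIter_zero] at this
  simp [Rop, this]

lemma Mop_radial (n m : ℕ) [hn : Fact (1 ≤ n)] (hnm : n = 2 * m + 1) (hm : 1 ≤ m) (g : ℝ → ℝ)
    (hg : Continuous g) (x : Rn n) (hx : x ≠ 0) (s : ℝ) :
    Mop n (fun y => g ‖y‖) x s = (1 / omegaN n) * (kapS n m *
      ∫ z in (-1:ℝ)..1, g (Real.sqrt (‖x‖ ^ 2 + s ^ 2 + 2 * ‖x‖ * s * z)) * (1 - z ^ 2) ^ (m - 1)) := by
  rw [Mop_eq n (by omega)]
  congr 1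
  have hr : 0 < ‖x‖ := norm_pos_iff.2 hx
  rw [← radial_cont n m hnm hm (fun z => g (Real.sqrt (‖x‖ ^ 2 + s ^ 2 + 2 * ‖x‖ * s * z))) (by fun_prop)
    (‖x‖⁻¹ • x) (by rw [norm_smul]; simp [hr.ne'])]
  apply integral_congr_ae
  filter_upwards [muS_ae_norm n] with w hw
  congr 1
  rw [← Real.sqrt_sq (norm_nonneg (x + s • w)), norm_add_sq_real, inner_smul_left, inner_smul_right, norm_smul, hw]
  congr 1
  simp only [Real.norm_eq_abs, mul_one, sq_abs, RCLike.conj_to_real]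
  field_simp
  ring

/-- the polynomial `(1 - X^2)^N` -/
def QP (N : ℕ) : Polynomial ℝ := (1 - Polynomial.X ^ 2) ^ N

lemma QP_eval_one (N j : ℕ) (hj : j < N) : (Polynomial.derivative^[j] (QP N)).eval 1 = 0 := by
  obtain ⟨c, hc⟩ := Polynomial.pow_sub_dvd_iterate_derivative_pow (1 - Polynomial.X ^ 2 : Polynomial ℝ) N j
  rw [QP, hc]
  simp
  left
  omega

lemma QP_LB (N : ℕ) (y : ℝ) : (-1) ^ N * (Polynomial.derivative^[N] (QP N)).eval y = (LB N).eval y := by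
  have : QP N = Polynomial.C ((-1) ^ N) * (Polynomial.X ^ 2 - 1) ^ N := by
    rw [QP, Polynomial.C_pow, ← mul_pow]; congr 1; simp
  rw [this, Polynomial.iterate_derivative_C_mul, LB]
  simp [← mul_assoc, ← mul_pow]

lemma F_formula (n m : ℕ) [hn : Fact (1 ≤ n)] (hnm : n = 2 * m + 1) (hm : 1 ≤ m) (g : ℝ → ℝ)
    (hg : Continuous g) (k : ℝ) (hsupp : ∀ s : ℝ, k < s → g s = 0)
    (x : Rn n) (s : ℝ) (hs : 0 < s) (hsr : s < ‖x‖) (hk : k < ‖x‖ + s) (hk0 : 0 < k) :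
    s ^ (2 * (n / 2) - 1) * Mop n (fun y => g ‖y‖) x s =
      (1 / omegaN n * kapS n m / ‖x‖) * ∫ l in (‖x‖ - s)..k, (g l * l ^ (2 * m - 1)) *
        (QP (m - 1)).eval ((l ^ 2 + ‖x‖ ^ 2) / (2 * ‖x‖ * l) + (-1 / (2 * ‖x‖ * l)) * s ^ 2) := by
  have hr : 0 < ‖x‖ := hs.trans hsr
  rw [Mop_radial n m hnm hm g hg x (norm_pos_iff.1 hr) s]
  set r := ‖x‖ with hrdef
  have h2m : 2 * (n / 2) - 1 = 2 * (m - 1) + 1 := by omega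
  have h2m' : 2 * m - 1 = 2 * (m - 1) + 1 := by omega
  rw [h2m, h2m']
  set N := m - 1
  have hcv := intervalIntegral.integral_comp_mul_deriv (a := r - s) (b := r + s)
    (f := fun l => (l ^ 2 - r ^ 2 - s ^ 2) / (2 * r * s)) (f' := fun l => l / (r * s))
    (g := fun z => g (Real.sqrt (r ^ 2 + s ^ 2 + 2 * r * s * z)) * (1 - z ^ 2) ^ N)
    (by
      intro l _
      have := (((hasDerivAt_pow 2 l).sub_const (r ^ 2)).sub_const (s ^ 2)).div_const (2 * r * s)
      refine this.congr_deriv ?_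
      simp; field_simp) (by fun_prop) (by fun_prop)
  have ha : ((r - s) ^ 2 - r ^ 2 - s ^ 2) / (2 * r * s) = -1 := by field_simp; ring
  have hb : ((r + s) ^ 2 - r ^ 2 - s ^ 2) / (2 * r * s) = 1 := by field_simp; ring
  simp only [ha, hb] at hcv
  rw [← hcv]
  let G : ℝ → ℝ := fun l => (g l * l ^ (2 * N + 1)) *
        (QP N).eval ((l ^ 2 + r ^ 2) / (2 * r * l) + (-1 / (2 * r * l)) * s ^ 2)
  have hrs : 0 < r - s := by linarith
  have hGc : ContinuousOn G (Set.Ioi 0) := by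
    have hne : ∀ l ∈ Set.Ioi (0:ℝ), 2 * r * l ≠ 0 := fun l hl => by
      have : 0 < l := hl
      positivity
    apply ContinuousOn.mul (by fun_prop)
    apply (QP N).continuous.comp_continuousOn
    apply ContinuousOn.add
    · exact ContinuousOn.div (by fun_prop) (by fun_prop) hne
    · exact (ContinuousOn.div (by fun_prop) (by fun_prop) hne).mul (by fun_prop)
  have hsplit : ∫ l in (r - s)..(r + s), G l = ∫ l in (r - s)..k, G l := by
    rw [← intervalIntegral.integral_add_adjacent_intervals (b := k)
      (hGc.mono (uIcc_sub_Ioi hrs hk0)).intervalIntegrable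
      (hGc.mono (uIcc_sub_Ioi hk0 (by linarith))).intervalIntegrable]
    have : ∫ l in k..(r + s), G l = 0 := by
      rw [intervalIntegral.integral_congr_ae (g := fun _ => (0:ℝ))]
      · simp
      · refine Filter.Eventually.of_forall ?_
        intro l hl
        rw [Set.uIoc_of_le hk.le] at hl
        simp [G, hsupp l hl.1]
    rw [this, add_zero]
  change _ = _ * ∫ l in (r - s)..k, G l
  rw [← hsplit]
  have hfin : s ^ (2 * N + 1) * ∫ l in (r - s)..(r + s), ((fun z => g (Real.sqrt (r ^ 2 + s ^ 2 + 2 * r * s * z)) * (1 - z ^ 2) ^ N) ∘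
      fun l => (l ^ 2 - r ^ 2 - s ^ 2) / (2 * r * s)) l * (l / (r * s)) =
      1 / r * ∫ l in (r - s)..(r + s), G l := by
    rw [← intervalIntegral.integral_const_mul, ← intervalIntegral.integral_const_mul]
    apply intervalIntegral.integral_congr
    intro l hl
    have hl0 : 0 < l := uIcc_sub_Ioi hrs (by linarith) hl
    simp only [Function.comp, G]
    have e1 : Real.sqrt (r ^ 2 + s ^ 2 + 2 * r * s * ((l ^ 2 - r ^ 2 - s ^ 2) / (2 * r * s))) = l := by
      rw [show r ^ 2 + s ^ 2 + 2 * r * s * ((l ^ 2 - r ^ 2 - s ^ 2) / (2 * r * s)) = l ^ 2 by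
        field_simp; ring]
      exact Real.sqrt_sq hl0.le
    rw [e1]
    have e2 : s ^ 2 * (1 - ((l ^ 2 - r ^ 2 - s ^ 2) / (2 * r * s)) ^ 2) =
        l ^ 2 * (1 - ((l ^ 2 + r ^ 2) / (2 * r * l) + (-1 / (2 * r * l)) * s ^ 2) ^ 2) := by
      field_simp; ring
    have e3 : (QP N).eval ((l ^ 2 + r ^ 2) / (2 * r * l) + (-1 / (2 * r * l)) * s ^ 2) =
      (1 - ((l ^ 2 + r ^ 2) / (2 * r * l) + (-1 / (2 * r * l)) * s ^ 2) ^ 2) ^ N := by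
      simp [QP]
    rw [e3]
    have e4 := congrArg (fun a => a ^ N) e2
    simp only [mul_pow] at e4
    have p1 : s ^ (2 * N + 1) = (s ^ 2) ^ N * s := by rw [pow_succ, pow_mul]
    have p2 : l ^ (2 * N + 1) = (l ^ 2) ^ N * l := by rw [pow_succ, pow_mul]
    rw [p1, p2]
    generalize (1 - ((l ^ 2 - r ^ 2 - s ^ 2) / (2 * r * s)) ^ 2) ^ N = a at e4 ⊢
    generalize (1 - ((l ^ 2 + r ^ 2) / (2 * r * l) + (-1 / (2 * r * l)) * s ^ 2) ^ 2) ^ N = b at e4 ⊢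
    generalize (s ^ 2) ^ N = S at e4 ⊢
    generalize (l ^ 2) ^ N = S' at e4 ⊢
    have : s ≠ 0 := hs.ne'
    have : r ≠ 0 := hr.ne'
    field_simp
    linear_combination (g l) * e4
  linear_combination (1 / omegaN n * kapS n m) * hfin

lemma Dt_formula (r k : ℝ) (hk0 : 0 < k) (hr : 0 < r) (F : ℝ → ℝ) (K : ℝ) (w : ℝ → ℝ)
    (hw : ContinuousOn w (Set.Ioi 0)) (N : ℕ)
    (hF : ∀ s, 0 < s → s < r → k < r + s → F s = K * ∫ l in (r - s)..k, w l *
        (QP N).eval ((l ^ 2 + r ^ 2) / (2 * r * l) + (-1 / (2 * r * l)) * s ^ 2)) (j : ℕ) (hj : j ≤ N) :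
    ∀ s, 0 < s → s < r → k < r + s → DtIter j F s = K * ∫ l in (r - s)..k, (w l * (-1 / (r * l)) ^ j) *
        (Polynomial.derivative^[j] (QP N)).eval ((l ^ 2 + r ^ 2) / (2 * r * l) + (-1 / (2 * r * l)) * s ^ 2) := by
  induction j with
  | zero => simpa [DtIter] using hF
  | succ j ih =>
    have ih := ih (by omega)
    intro s hs hsr hks
    have hopen : {u | 0 < u ∧ u < r ∧ k < r + u} ∈ nhds s := by
      have ho : IsOpen {u : ℝ | 0 < u ∧ u < r ∧ k < r + u} :=
        (isOpen_lt (f := fun _ : ℝ => (0:ℝ)) (g := fun u => u) (by fun_prop) (by fun_prop)).inter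
          ((isOpen_lt (f := fun u : ℝ => u) (g := fun _ => r) (by fun_prop) (by fun_prop)).inter
            (isOpen_lt (f := fun _ : ℝ => k) (g := fun u => r + u) (by fun_prop) (by fun_prop)))
      exact ho.mem_nhds ⟨hs, hsr, hks⟩
    have hev : DtIter j F =ᶠ[nhds s] fun s => K * ∫ l in (r - s)..k, (w l * (-1 / (r * l)) ^ j) *
        (Polynomial.derivative^[j] (QP N)).eval ((l ^ 2 + r ^ 2) / (2 * r * l) + (-1 / (2 * r * l)) * s ^ 2) := by
      filter_upwards [hopen] with u hu using ih u hu.1 hu.2.1 hu.2.2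
    have hne : ∀ l ∈ Set.Ioi (0:ℝ), 2 * r * l ≠ 0 := fun l hl => by
      have : 0 < l := hl
      positivity
    have hne' : ∀ l ∈ Set.Ioi (0:ℝ), r * l ≠ 0 := fun l hl => by
      have : 0 < l := hl
      positivity
    have hd := (deriv_I r k hk0 (fun l => (l ^ 2 + r ^ 2) / (2 * r * l)) (fun l => -1 / (2 * r * l))
      (fun l => w l * (-1 / (r * l)) ^ j)
      (ContinuousOn.div (by fun_prop) (by fun_prop) hne) (ContinuousOn.div (by fun_prop) (by fun_prop) hne)
      (hw.mul ((ContinuousOn.div (by fun_prop) (by fun_prop) hne').pow j))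
      (Polynomial.derivative^[j] (QP N)) s (by linarith)).const_mul K
    have hd2 := (hd.congr_of_eventuallyEq hev).deriv
    simp only [DtIter]
    rw [hd2]
    have hy1 : ((r - s) ^ 2 + r ^ 2) / (2 * r * (r - s)) + (-1 / (2 * r * (r - s))) * s ^ 2 = 1 := by
      have : r - s ≠ 0 := by linarith
      field_simp; ring
    rw [hy1, QP_eval_one N j (by omega), mul_zero, zero_add, mul_left_comm, ← intervalIntegral.integral_const_mul]
    congr 1
    apply intervalIntegral.integral_congr
    intro l hl
    have hl0 : 0 < l := uIcc_sub_Ioi (by linarith) hk0 hl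
    simp only [Function.iterate_succ_apply', pow_succ]
    have : s ≠ 0 := hs.ne'
    field_simp

lemma Rop_lower (n m : ℕ) [hn : Fact (1 ≤ n)] (hnm : n = 2 * m + 1) (hm : 1 ≤ m) (k k₀ k₁ : ℝ)
    (hk₀ : 0 < k₀) (h₀₁ : k₀ < k₁) (h₁k : k₁ < k)
    (g : ℝ → ℝ) (hg : Continuous g)
    (hsupp : ∀ s : ℝ, k < s → g s = 0)
    (hpos : ∀ s : ℝ, k₀ < s → s < k → 0 ≤ g s)
    (hint : 0 < ∫ lam in ((k₁ + k) / 2)..k, lam ^ (n / 2) * g lam)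
    (hLeg : ∀ z : ℝ, k₀ / k < z → 1 / 2 < legendreP m z) :
    ∃ c > 0, ∀ (x : Rn n) (t : ℝ), 0 ≤ t → k₁ ≤ ‖x‖ - t → ‖x‖ - t ≤ (k₁ + k) / 2 → k < ‖x‖ + t →
      c * (‖x‖ ^ m)⁻¹ ≤ Rop n (fun y => g ‖y‖) x t := by
  have hk : 0 < k := by linarith
  obtain ⟨N, rfl⟩ := Nat.exists_eq_add_of_le' hm
  have hn2 : n / 2 = N + 1 := by omega
  obtain ⟨δ, hδ, hδ2⟩ := LB_lower N (k₀ / k) (k₁ / k) (by positivity) (by gcongr)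
    (by rw [div_lt_one hk]; exact h₁k) hLeg
  have hom := omegaN_pos n hn.out
  have hkap := kapS_pos n (N + 1)
  set I := ∫ lam in ((k₁ + k) / 2)..k, lam ^ (n / 2) * g lam with hI
  set d : ℝ := 1 / (Nat.doubleFactorial (2 * (n / 2) - 1) : ℝ) with hd
  have hdpos : 0 < d := by
    rw [hd]; have := Nat.doubleFactorial_pos (2 * (n / 2) - 1); positivity
  refine ⟨d * (1 / omegaN n * kapS n (N + 1)) * (δ * I), by positivity, ?_⟩
  intro x t ht0 h1 h2 h3
  set r := ‖x‖ with hrdef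
  have ht : 0 < t := by
    rcases lt_or_eq_of_le ht0 with h | h
    · exact h
    · exfalso; subst h; linarith
  have hr : 0 < r := by linarith
  have hDt := Dt_formula r k hk hr (fun s => s ^ (2 * (n / 2) - 1) * Mop n (fun y => g ‖y‖) x s)
    (1 / omegaN n * kapS n (N + 1) / r) (fun l => g l * l ^ (2 * (N + 1) - 1)) (by fun_prop) N
    (fun s hs hsr hks => F_formula n (N + 1) hnm hm g hg k hsupp x s hs hsr hks hk) N le_rfl t ht (by linarith) h3
  have hR : Rop n (fun y => g ‖y‖) x t = d * (1 / omegaN n * kapS n (N + 1)) * ((r ^ (N + 1))⁻¹ *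
      ∫ l in (r - t)..k, l ^ (n / 2) * g l * (LB N).eval ((l ^ 2 + r ^ 2) / (2 * r * l) + (-1 / (2 * r * l)) * t ^ 2)) := by
    unfold Rop
    have e0 : n / 2 - 1 = N := by omega
    rw [e0, hDt, ← hd]
    have e1 : ∫ l in (r - t)..k, (g l * l ^ (2 * (N + 1) - 1) * (-1 / (r * l)) ^ N) *
        (Polynomial.derivative^[N] (QP N)).eval ((l ^ 2 + r ^ 2) / (2 * r * l) + (-1 / (2 * r * l)) * t ^ 2) =
        (r ^ N)⁻¹ * ∫ l in (r - t)..k, l ^ (n / 2) * g l * (LB N).eval ((l ^ 2 + r ^ 2) / (2 * r * l) + (-1 / (2 * r * l)) * t ^ 2) := by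
      rw [← intervalIntegral.integral_const_mul]
      apply intervalIntegral.integral_congr
      intro l hl
      have hl0 : 0 < l := uIcc_sub_Ioi (by linarith) hk hl
      simp only
      rw [← QP_LB, hn2, show 2 * (N + 1) - 1 = N + (N + 1) by omega, div_pow, mul_pow, pow_add]
      field_simp
    rw [e1, pow_succ r N]
    generalize (∫ l in (r - t)..k, l ^ (n / 2) * g l * (LB N).eval ((l ^ 2 + r ^ 2) / (2 * r * l) + (-1 / (2 * r * l)) * t ^ 2)) = J
    field_simp
  rw [hR]
  have hc : 0 ≤ d * (1 / omegaN n * kapS n (N + 1)) := by positivity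
  have hmain : δ * I ≤ ∫ l in (r - t)..k, l ^ (n / 2) * g l * (LB N).eval ((l ^ 2 + r ^ 2) / (2 * r * l) + (-1 / (2 * r * l)) * t ^ 2) := by
    have hgk : ∀ l, k₁ ≤ l → l ≤ k → 0 ≤ g l := by
      intro l h4 h5
      have hcl : IsClosed {l | 0 ≤ g l} := isClosed_le continuous_const hg
      have : Set.Icc k₁ k ⊆ {l | 0 ≤ g l} := by
        rw [← closure_Ioo h₁k.ne]
        apply hcl.closure_subset_iff.2
        intro y hy
        exact hpos y (by linarith [hy.1]) hy.2
      exact this ⟨h4, h5⟩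
    have hpt : ∀ l, r - t ≤ l → l ≤ k → δ * (l ^ (n / 2) * g l) ≤
        l ^ (n / 2) * g l * (LB N).eval ((l ^ 2 + r ^ 2) / (2 * r * l) + (-1 / (2 * r * l)) * t ^ 2) := by
      intro l h4 h5
      have hl0 : 0 < l := by linarith
      rw [mul_comm δ]
      have hnn : 0 ≤ l ^ (n / 2) * g l := mul_nonneg (by positivity) (hgk l (by linarith) h5)
      apply mul_le_mul_of_nonneg_left _ hnn
      apply hδ2
      have hy : (l ^ 2 + r ^ 2) / (2 * r * l) + (-1 / (2 * r * l)) * t ^ 2 = (l ^ 2 + r ^ 2 - t ^ 2) / (2 * r * l) := by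
        field_simp; ring
      rw [hy]
      constructor
      · rw [div_le_div_iff₀ hk (by positivity)]
        have a1 : k₁ * (2 * r * l) ≤ (r - t) * (2 * r * l) := mul_le_mul_of_nonneg_right h1 (by positivity)
        have a2 : (r - t) * (2 * r) ≤ (l ^ 2 + r ^ 2 - t ^ 2) := by nlinarith
        have a3 : (r - t) * (2 * r) * l ≤ (r - t) * (2 * r) * k := by
          apply mul_le_mul_of_nonneg_left h5
          have : 0 < r - t := by linarith
          positivity
        have a4 := mul_le_mul_of_nonneg_right a2 hk.le
        nlinarith
      · rw [div_le_one (by positivity)]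
        nlinarith [mul_nonneg (by linarith : 0 ≤ l - (r - t)) (by linarith : 0 ≤ (r + t) - l)]
    have hrt : 0 < r - t := by linarith
    have hc1 : ContinuousOn (fun l => l ^ (n / 2) * g l * (LB N).eval ((l ^ 2 + r ^ 2) / (2 * r * l) + (-1 / (2 * r * l)) * t ^ 2)) (Set.Ioi 0) := by
      have hne : ∀ l ∈ Set.Ioi (0:ℝ), 2 * r * l ≠ 0 := fun l hl => by
        have : 0 < l := hl
        positivity
      apply ContinuousOn.mul (by fun_prop)
      apply (LB N).continuous.comp_continuousOn
      apply ContinuousOn.add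
      · exact ContinuousOn.div (by fun_prop) (by fun_prop) hne
      · exact (ContinuousOn.div (by fun_prop) (by fun_prop) hne).mul (by fun_prop)
    have hm1 : (k₁ + k) / 2 < k := by linarith
    have step1 : ∫ l in (r - t)..k, δ * (l ^ (n / 2) * g l) ≤ ∫ l in (r - t)..k, l ^ (n / 2) * g l * (LB N).eval ((l ^ 2 + r ^ 2) / (2 * r * l) + (-1 / (2 * r * l)) * t ^ 2) := by
      apply intervalIntegral.integral_mono_on (by linarith)
      · apply Continuous.intervalIntegrable; fun_prop
      · exact (hc1.mono (uIcc_sub_Ioi hrt hk)).intervalIntegrable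
      · intro l hl; exact hpt l hl.1 hl.2
    refine le_trans ?_ step1
    rw [intervalIntegral.integral_const_mul]
    apply mul_le_mul_of_nonneg_left _ hδ.le
    rw [← intervalIntegral.integral_add_adjacent_intervals (a := r - t) (b := (k₁ + k) / 2) (c := k)
      (by apply Continuous.intervalIntegrable; fun_prop) (by apply Continuous.intervalIntegrable; fun_prop)]
    have : 0 ≤ ∫ l in (r - t)..((k₁ + k) / 2), l ^ (n / 2) * g l := by
      apply intervalIntegral.integral_nonneg h2
      intro l hl
      exact mul_nonneg (pow_nonneg (by linarith [hl.1]) _) (hgk l (by linarith [hl.1]) (by linarith [hl.2]))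
    linarith
  rw [mul_assoc]
  apply mul_le_mul_of_nonneg_left _ hc
  rw [mul_comm]
  exact mul_le_mul_of_nonneg_left hmain (by positivity)

lemma Lop_lower (n : ℕ) [hn : Fact (1 ≤ n)] (hodd : n % 2 = 1) (h3 : 3 ≤ n) (Ψ : Rn n → ℝ → ℝ)
    (hΨ : Continuous (fun q : Rn n × ℝ => Ψ q.1 q.2)) (x : Rn n) (t B : ℝ) (ht : 0 ≤ t)
    (hB : ∀ w : Rn n, ‖w‖ = 1 → B ≤ ∫ s in (0:ℝ)..t, s * Ψ (x + s • w) (t - s)) :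
    (1 / (2 * ((n / 2 : ℕ) : ℝ) - 1)) * (1 / omegaN n) * (muS n).real Set.univ * B ≤ Lop n Ψ x t := by
  have hom := omegaN_pos n hn.out
  have h2 : (0:ℝ) < 2 * ((n / 2 : ℕ) : ℝ) - 1 := by
    have : (1:ℝ) ≤ ((n / 2 : ℕ) : ℝ) := by
      have : 1 ≤ n / 2 := by omega
      exact_mod_cast this
    linarith
  have hF : Continuous (fun q : ℝ × Rn n => q.1 * Ψ (x + q.1 • q.2) (t - q.1)) := by
    apply continuous_fst.mul
    exact hΨ.comp (f := fun q : ℝ × Rn n => (x + q.1 • q.2, t - q.1)) (by fun_prop)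
  have hInt : Integrable (fun q : ℝ × Rn n => q.1 * Ψ (x + q.1 • q.2) (t - q.1))
      ((volume.restrict (Set.uIoc 0 t)).prod (muS n)) := by
    have hK : IsCompact (Set.Icc 0 t ×ˢ Metric.sphere (0 : Rn n) 1) :=
      isCompact_Icc.prod (isCompact_sphere _ _)
    obtain ⟨M, hM⟩ := hK.exists_bound_of_continuousOn hF.continuousOn
    have hfin : IsFiniteMeasure (volume.restrict (Set.uIoc 0 t)) := by
      rw [Set.uIoc_of_le ht]; infer_instance
    refine Integrable.of_bound hF.aestronglyMeasurable M ?_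
    have a1 : ∀ᵐ q ∂((volume.restrict (Set.uIoc 0 t)).prod (muS n)), q.1 ∈ Set.uIoc 0 t :=
      Measure.quasiMeasurePreserving_fst.ae (p := fun s => s ∈ Set.uIoc 0 t)
        (ae_restrict_mem measurableSet_uIoc)
    have a2 : ∀ᵐ q ∂((volume.restrict (Set.uIoc 0 t)).prod (muS n)), ‖q.2‖ = 1 :=
      Measure.quasiMeasurePreserving_snd.ae (p := fun w : Rn n => ‖w‖ = 1) (muS_ae_norm n)
    filter_upwards [a1, a2] with q h1 h2
    apply hM
    rw [Set.uIoc_of_le ht] at h1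
    exact ⟨⟨h1.1.le, h1.2⟩, by simpa using h2⟩
  have hL : Lop n Ψ x t = (1 / (2 * ((n / 2 : ℕ) : ℝ) - 1)) * (1 / omegaN n) *
      ∫ w, (∫ s in (0:ℝ)..t, s * Ψ (x + s • w) (t - s)) ∂muS n := by
    have e1 : ∫ τ in (0:ℝ)..t, (t - τ) * Mop n (fun y => Ψ y τ) x (t - τ) =
        ∫ s in (0:ℝ)..t, (1 / omegaN n) * ∫ w, s * Ψ (x + s • w) (t - s) ∂muS n := by
      have := intervalIntegral.integral_comp_sub_left (a := 0) (b := t)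
        (fun s => (1 / omegaN n) * ∫ w, s * Ψ (x + s • w) (t - s) ∂muS n) t
      simp only [sub_self, sub_zero, sub_sub_cancel] at this
      rw [← this]
      congr 1
      ext τ
      rw [Mop_eq n hodd, integral_const_mul]
      ring
    unfold Lop
    rw [e1, intervalIntegral.integral_const_mul]
    rw [intervalIntegral_integral_swap hInt]
    ring
  rw [hL, mul_assoc]
  apply mul_le_mul_of_nonneg_left _ (by positivity)
  have hc : (muS n).real Set.univ * B = ∫ w, B ∂muS n := by simp
  rw [hc]
  apply integral_mono_ae (integrable_const _)
  · have := hInt.integral_prod_right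
    refine this.congr (Filter.Eventually.of_forall fun w => ?_)
    simp only [intervalIntegral.integral_of_le ht, Set.uIoc_of_le ht]
  · filter_upwards [muS_ae_norm n] with w hw using hB w hw

lemma interval_lower (f : ℝ → ℝ) (hf : Continuous f) (t s₁ s₂ v : ℝ) (h1 : 0 ≤ s₁) (h12 : s₁ ≤ s₂)
    (h2 : s₂ ≤ t) (hnn : ∀ s, 0 ≤ s → s ≤ t → 0 ≤ f s) (hv : ∀ s, s₁ ≤ s → s ≤ s₂ → v ≤ f s) :
    v * (s₂ - s₁) ≤ ∫ s in (0:ℝ)..t, f s := by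
  have e1 : ∫ s in s₁..s₂, f s ≤ ∫ s in (0:ℝ)..t, f s := by
    apply intervalIntegral.integral_mono_interval h1 h12 h2 _ (hf.intervalIntegrable _ _)
    filter_upwards [ae_restrict_mem measurableSet_Ioc] with s hs using hnn s hs.1.le hs.2
  refine le_trans ?_ e1
  have e2 : v * (s₂ - s₁) = ∫ s in s₁..s₂, v := by simp [mul_comm]
  rw [e2]
  exact intervalIntegral.integral_mono_on h12 (by simp) (hf.intervalIntegrable _ _)
    (fun s hs => hv s hs.1 hs.2)

/-- the constant in front of the potential -/
def KL (n : ℕ) : ℝ := (1 / (2 * ((n / 2 : ℕ) : ℝ) - 1)) * (1 / omegaN n) * (muS n).real Set.univ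

lemma KL_pos (n : ℕ) (h3 : 3 ≤ n) : 0 < KL n := by
  have hfact : Fact (1 ≤ n) := ⟨by omega⟩
  have hom := omegaN_pos n (by omega)
  have h2 : (0:ℝ) < 2 * ((n / 2 : ℕ) : ℝ) - 1 := by
    have : (1:ℝ) ≤ ((n / 2 : ℕ) : ℝ) := by
      have : 1 ≤ n / 2 := by omega
      exact_mod_cast this
    linarith
  have := muS_pos (n := n)
  unfold KL
  positivity

lemma slice_cont {n : ℕ} {p : ℝ} (hp1 : 1 < p) {u : Rn n → ℝ → ℝ}
    (hu : Continuous (fun q : Rn n × ℝ => u q.1 q.2)) :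
    Continuous (fun q : Rn n × ℝ => |u q.1 q.2| ^ p) :=
  hu.abs.rpow_const (fun _ => Or.inr (by linarith))

lemma slice_cont' {n : ℕ} {p : ℝ} (hp1 : 1 < p) {u : Rn n → ℝ → ℝ}
    (hu : Continuous (fun q : Rn n × ℝ => u q.1 q.2)) (x w : Rn n) (t : ℝ) :
    Continuous (fun s : ℝ => s * |u (x + s • w) (t - s)| ^ p) :=
  continuous_id.mul ((slice_cont hp1 hu).comp (f := fun s : ℝ => (x + s • w, t - s)) (by fun_prop))

lemma Lop_step {n : ℕ} (hodd : n % 2 = 1) (hn : 5 ≤ n) {p : ℝ} (hp1 : 1 < p) {u : Rn n → ℝ → ℝ}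
    (hu : Continuous (fun q : Rn n × ℝ => u q.1 q.2)) (x : Rn n) (t a l : ℝ) (ht : 0 ≤ t) (ha : 0 ≤ a)
    (hl : 0 ≤ l)
    (H : ∀ w : Rn n, ‖w‖ = 1 → ∃ s₁ s₂, 0 ≤ s₁ ∧ s₁ ≤ s₂ ∧ s₂ ≤ t ∧ l ≤ s₂ - s₁ ∧
      ∀ s, s₁ ≤ s → s ≤ s₂ → a ≤ s * |u (x + s • w) (t - s)| ^ p) :
    KL n * (a * l) ≤ Lop n (fun y τ => |u y τ| ^ p) x t := by
  have hfact : Fact (1 ≤ n) := ⟨by omega⟩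
  apply Lop_lower n hodd (by omega) (fun y τ => |u y τ| ^ p) (slice_cont hp1 hu) x t _ ht
  intro w hw
  obtain ⟨s₁, s₂, h1, h12, h2, hls, h⟩ := H w hw
  calc a * l ≤ a * (s₂ - s₁) := by gcongr
    _ ≤ _ := interval_lower _ (slice_cont' hp1 hu x w t) t s₁ s₂ a h1 h12 h2
      (fun s hs _ => by positivity) h

lemma Lop_nonneg {n : ℕ} (hodd : n % 2 = 1) (hn : 5 ≤ n) {p : ℝ} (hp1 : 1 < p) {u : Rn n → ℝ → ℝ}
    (hu : Continuous (fun q : Rn n × ℝ => u q.1 q.2)) (x : Rn n) (t : ℝ) (ht : 0 ≤ t) :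
    0 ≤ Lop n (fun y τ => |u y τ| ^ p) x t := by
  have := Lop_step hodd hn hp1 hu x t 0 0 ht le_rfl le_rfl (fun w _ => ⟨0, 0, le_rfl, le_rfl, ht, by simp,
    fun s hs _ => by positivity⟩)
  simpa using this

lemma first_step {n m : ℕ} (hnm : n = 2 * m + 1) (hn : 5 ≤ n) {p : ℝ} (hp1 : 1 < p) {u : Rn n → ℝ → ℝ}
    (hu : Continuous (fun q : Rn n × ℝ => u q.1 q.2)) (T ε k k₁ c₀ : ℝ) (hε : 0 < ε) (hc₀ : 0 < c₀)
    (hk₁ : 0 < k₁) (h₁k : k₁ < k) (hT : 2 * k < T) (R : Rn n → ℝ → ℝ)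
    (hR0 : ∀ x t, k < t - ‖x‖ → R x t = 0)
    (hR : ∀ x t, 0 ≤ t → k₁ ≤ ‖x‖ - t → ‖x‖ - t ≤ (k₁ + k) / 2 → k < ‖x‖ + t → c₀ * (‖x‖ ^ m)⁻¹ ≤ R x t)
    (heq : ∀ x, ∀ t ∈ Set.Icc (0:ℝ) T, u x t = ε * R x t + Lop n (fun y τ => |u y τ| ^ p) x t)
    (x : Rn n) (t : ℝ) (htT : t ≤ T) (hxt : T / 2 ≤ t - ‖x‖) :
    KL n * (T / 4 * (ε * (c₀ * ((2 * T) ^ m)⁻¹)) ^ p * ((k - k₁) / 4)) ≤ u x t := by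
  have hodd : n % 2 = 1 := by omega
  have hx0 := norm_nonneg x
  have ht0 : 0 ≤ t := by linarith
  have hTpos : 0 < T := by linarith
  rw [heq x t ⟨ht0, htT⟩, hR0 x t (by linarith), mul_zero, zero_add]
  apply Lop_step hodd hn hp1 hu x t _ _ ht0 (by positivity) (by linarith)
  intro w hw
  set φ : ℝ → ℝ := fun s => ‖x + s • w‖ + s - t with hφ
  have hφc : Continuous φ := by fun_prop
  have hdiff : ∀ s s', s ≤ s' → |‖x + s' • w‖ - ‖x + s • w‖| ≤ s' - s := by
    intro s s' hs
    refine (abs_norm_sub_norm_le _ _).trans ?_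
    rw [show x + s' • w - (x + s • w) = (s' - s) • w by rw [sub_smul]; abel, norm_smul, hw, mul_one,
      Real.norm_eq_abs, abs_of_nonneg (by linarith)]
  have hφ0 : φ 0 ≤ -(T / 2) := by simp only [hφ, zero_smul, add_zero]; linarith
  have hlow : ∀ s, 0 ≤ s → s - ‖x‖ ≤ ‖x + s • w‖ ∧ ‖x + s • w‖ ≤ ‖x‖ + s := by
    intro s hs
    have e : ‖s • w‖ = s := by rw [norm_smul, hw, mul_one, Real.norm_eq_abs, abs_of_nonneg hs]
    constructor
    · have := norm_sub_le (x + s • w) x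
      rw [add_sub_cancel_left, e] at this
      linarith
    · have := norm_add_le x (s • w)
      rwa [e] at this
  have hφt : T / 2 ≤ φ t := by
    have := (hlow t ht0).1
    simp only [hφ]; linarith
  obtain ⟨s₂, hs₂, hs₂'⟩ := intermediate_value_Icc ht0 hφc.continuousOn
    (show (k₁ + k) / 2 ∈ Set.Icc (φ 0) (φ t) from ⟨by linarith, by linarith⟩)
  obtain ⟨s₁, hs₁, hs₁'⟩ := intermediate_value_Icc hs₂.1 hφc.continuousOn
    (show k₁ ∈ Set.Icc (φ 0) (φ s₂) from ⟨by linarith, by linarith⟩)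
  have hmono : ∀ s s', s ≤ s' → φ s ≤ φ s' := by
    intro s s' h
    have := (abs_le.1 (hdiff s s' h)).1
    simp only [hφ]; linarith
  refine ⟨s₁, s₂, hs₁.1, hs₁.2, hs₂.2, ?_, ?_⟩
  · have := (abs_le.1 (hdiff s₁ s₂ hs₁.2)).2
    simp only [hφ] at hs₁' hs₂'
    linarith
  · intro s h1 h2
    have hs0 : 0 ≤ s := hs₁.1.trans h1
    have hst : s ≤ t := h2.trans hs₂.2
    have m1 := hmono _ _ h1
    have m2 := hmono _ _ h2
    rw [hs₁'] at m1
    rw [hs₂'] at m2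
    simp only [hφ] at m1 m2
    obtain ⟨l1, l2⟩ := hlow s hs0
    have hRl := hR (x + s • w) (t - s) (by linarith) (by linarith) (by linarith) (by linarith)
    have hpos : 0 < ‖x + s • w‖ := by linarith
    have hle : ‖x + s • w‖ ≤ 2 * T := by linarith
    have hinv : ((2 * T) ^ m)⁻¹ ≤ (‖x + s • w‖ ^ m)⁻¹ := by gcongr
    have hul : ε * (c₀ * ((2 * T) ^ m)⁻¹) ≤ u (x + s • w) (t - s) := by
      rw [heq (x + s • w) (t - s) ⟨by linarith, by linarith⟩]
      have := Lop_nonneg hodd hn hp1 hu (x + s • w) (t - s) (by linarith)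
      have : ε * (c₀ * ((2 * T) ^ m)⁻¹) ≤ ε * R (x + s • w) (t - s) := by
        apply mul_le_mul_of_nonneg_left _ hε.le
        refine le_trans ?_ hRl
        gcongr
      linarith
    apply mul_le_mul (by linarith) _ (by positivity) hs0
    apply Real.rpow_le_rpow (by positivity) (hul.trans (le_abs_self _)) (by linarith)

lemma iter_step {n : ℕ} (hodd : n % 2 = 1) (hn : 5 ≤ n) {p : ℝ} (hp1 : 1 < p) {u : Rn n → ℝ → ℝ}
    (hu : Continuous (fun q : Rn n × ℝ => u q.1 q.2)) (T A b h : ℝ) (hA : 0 ≤ A) (hb : 0 ≤ b) (hh : 0 ≤ h)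
    (heq : ∀ x t, t ≤ T → b ≤ t - ‖x‖ → u x t = Lop n (fun y τ => |u y τ| ^ p) x t)
    (hlow : ∀ x t, t ≤ T → b ≤ t - ‖x‖ → A ≤ u x t)
    (x : Rn n) (t : ℝ) (htT : t ≤ T) (hxt : b + h ≤ t - ‖x‖) :
    KL n * (A ^ p * h ^ 2 / 16) ≤ u x t := by
  have hx0 := norm_nonneg x
  rw [heq x t htT (by linarith)]
  rw [show A ^ p * h ^ 2 / 16 = (h / 4 * A ^ p) * (h / 4) by ring]
  apply Lop_step hodd hn hp1 hu x t _ _ (by linarith) (by positivity) (by linarith)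
  intro w hw
  refine ⟨h / 4, h / 2, by linarith, by linarith, by linarith, by linarith, ?_⟩
  intro s h1 h2
  have hs : 0 ≤ s := by linarith
  have e : ‖s • w‖ = s := by rw [norm_smul, hw, mul_one, Real.norm_eq_abs, abs_of_nonneg hs]
  have := norm_add_le x (s • w)
  rw [e] at this
  have := hlow (x + s • w) (t - s) (by linarith) (by linarith)
  apply mul_le_mul h1 _ (by positivity) hs
  apply Real.rpow_le_rpow hA (this.trans (le_abs_self _)) (by linarith)

lemma blowup {n : ℕ} (hodd : n % 2 = 1) (hn : 5 ≤ n) {p : ℝ} (hp1 : 1 < p) {u : Rn n → ℝ → ℝ}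
    (hu : Continuous (fun q : Rn n × ℝ => u q.1 q.2)) (T A : ℝ) (hT : 0 < T) (hA : 0 < A)
    (heq : ∀ x t, t ≤ T → T / 2 ≤ t - ‖x‖ → u x t = Lop n (fun y τ => |u y τ| ^ p) x t)
    (hlow : ∀ x t, t ≤ T → T / 2 ≤ t - ‖x‖ → A ≤ u x t)
    (hbig : (4:ℝ) ^ (1 / (p - 1)) ≤ KL n * (T / 4) ^ 2 / 16 * A ^ (p - 1)) : False := by
  have hp : 0 < p - 1 := by linarith
  set θ : ℝ := (4:ℝ) ^ (1 / (p - 1)) with hθ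
  have hθ1 : 1 < θ := Real.one_lt_rpow (by norm_num) (by positivity)
  have hθp : θ ^ (p - 1) = 4 := by
    rw [hθ, ← Real.rpow_mul (by norm_num), one_div_mul_cancel hp.ne', Real.rpow_one]
  have key : ∀ j : ℕ, ∀ x t, t ≤ T → T - (T / 2) / 2 ^ j ≤ t - ‖x‖ → A * θ ^ j ≤ u x t := by
    intro j
    induction j with
    | zero =>
      intro x t h1 h2
      simp only [pow_zero, div_one, mul_one] at h2 ⊢
      exact hlow x t h1 (by linarith)
    | succ j ih =>
      intro x t h1 h2
      have hb : T / 2 ≤ T - (T / 2) / 2 ^ j := by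
        have : (T / 2) / 2 ^ j ≤ T / 2 := div_le_self (by positivity) (one_le_pow₀ (by norm_num))
        linarith
      have hAj : 0 < A * θ ^ j := by positivity
      have := iter_step hodd hn hp1 hu T (A * θ ^ j) (T - (T / 2) / 2 ^ j) ((T / 4) / 2 ^ j) hAj.le
        (by linarith) (by positivity) (fun x t h1 h2 => heq x t h1 (by linarith)) ih x t h1
        (by
          have e : T - T / 2 / 2 ^ j + T / 4 / 2 ^ j = T - T / 2 / 2 ^ (j + 1) := by
            rw [pow_succ]; field_simp; ring
          rw [e]; exact h2)
      refine le_trans ?_ this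
      have e1 : (A * θ ^ j) ^ p = A * θ ^ j * (A ^ (p - 1) * 4 ^ j) := by
        have q1 : (θ ^ j) ^ (p - 1) = 4 ^ j := by
          rw [← Real.rpow_natCast θ j, ← Real.rpow_mul (by positivity), mul_comm (j:ℝ),
            Real.rpow_mul (by positivity), hθp, Real.rpow_natCast]
        have q2 : (A * θ ^ j) ^ p = (A * θ ^ j) ^ (1 + (p - 1)) := by
          congr 1; ring
        rw [q2, Real.rpow_add hAj, Real.rpow_one, Real.mul_rpow hA.le (by positivity), q1]
      have e2 : KL n * ((A * θ ^ j) ^ p * (T / 4 / 2 ^ j) ^ 2 / 16) =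
          A * θ ^ j * (KL n * (T / 4) ^ 2 / 16 * A ^ (p - 1)) := by
        rw [e1, div_pow (T / 4), ← pow_mul, mul_comm j 2, pow_mul]
        norm_num
        field_simp
      rw [e2, pow_succ, ← mul_assoc]
      gcongr
  obtain ⟨j, hj⟩ := pow_unbounded_of_one_lt (u 0 T / A) hθ1
  have := key j 0 T le_rfl (by simp; positivity)
  rw [div_lt_iff₀ hA] at hj
  linarith

lemma gamma_pos (n : ℕ) (hn : 5 ≤ n) (p : ℝ) (hp1 : 1 < p) (hp2 : p < pCrit n) : 0 < gammaPN p n := by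
  have hn' : (5:ℝ) ≤ n := by exact_mod_cast hn
  unfold pCrit at hp2
  unfold gammaPN
  set N : ℝ := (n : ℝ)
  set S := Real.sqrt (N ^ 2 + 10 * N - 7) with hS
  have hS2 : S ^ 2 = N ^ 2 + 10 * N - 7 := Real.sq_sqrt (by nlinarith)
  have hS0 : 0 ≤ S := Real.sqrt_nonneg _
  rw [lt_div_iff₀ (by linarith)] at hp2
  have hS1 : N + 1 < S + 2 * (N + 1) := by nlinarith
  -- 4(N-1)γ = S^2 - (2(N-1)p - (N+1))^2
  have h1 : 0 < S - (2 * (N - 1) * p - (N + 1)) := by linarith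
  have h2 : 0 < S + (2 * (N - 1) * p - (N + 1)) := by nlinarith
  have h3 := mul_pos h1 h2
  have h4 : (S - (2 * (N - 1) * p - (N + 1))) * (S + (2 * (N - 1) * p - (N + 1))) =
    4 * (N - 1) * (2 + (N + 1) * p - (N - 1) * p ^ 2) := by
    linear_combination hS2
  rw [h4] at h3
  exact pos_of_mul_pos_right h3 (by linarith)

lemma const_choice (n m : ℕ) (hnm : n = 2 * m + 1) (p : ℝ) (hp1 : 1 < p) (hγ : 0 < gammaPN p n)
    (K c₀ d θ k : ℝ) (hK : 0 < K) (hc₀ : 0 < c₀) (hd : 0 < d) (hθ : 0 < θ) (hk : 0 < k) :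
    ∃ c > 0, ∀ ε, 0 < ε → ε ≤ 1 → ∀ T, c * ε ^ (-(2 * p * (p - 1) / gammaPN p n)) < T →
      2 * k < T ∧ θ ≤ K * (T / 4) ^ 2 / 16 * (K * (T / 4 * (ε * (c₀ * ((2 * T) ^ m)⁻¹)) ^ p * d)) ^ (p - 1) := by
  have hp : 0 < p - 1 := by linarith
  set γ := gammaPN p n with hγdef
  have hγ2 : γ / 2 = 2 + (1 - m * p) * (p - 1) := by
    rw [hγdef, gammaPN, hnm]; push_cast; ring
  set D : ℝ := K * (1 / 4 * (c₀ * (2 ^ m)⁻¹) ^ p * d) with hD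
  have hDpos : 0 < D := by positivity
  set c₂ : ℝ := (θ * 256 / (K * D ^ (p - 1))) ^ (2 / γ) with hc₂
  have hc₂pos : 0 < c₂ := by positivity
  refine ⟨max (2 * k) c₂, by positivity, ?_⟩
  intro ε hε hε1 T hT
  set α := 2 * p * (p - 1) / γ with hα
  have hαpos : 0 < α := by positivity
  have h1 : 1 ≤ ε ^ (-α) := Real.one_le_rpow_of_pos_of_le_one_of_nonpos hε hε1 (by linarith)
  have hT2k : 2 * k < T := by
    calc 2 * k ≤ max (2 * k) c₂ := le_max_left _ _
      _ ≤ max (2 * k) c₂ * ε ^ (-α) := le_mul_of_one_le_right (by positivity) h1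
      _ < T := hT
  refine ⟨hT2k, ?_⟩
  have hTpos : 0 < T := by linarith
  have h2 : c₂ ≤ ε ^ α * T := by
    have : c₂ * ε ^ (-α) ≤ T := by
      refine le_trans ?_ hT.le
      gcongr
      exact le_max_right _ _
    rw [Real.rpow_neg hε.le, ← div_eq_mul_inv, div_le_iff₀ (by positivity)] at this
    linarith
  have h3 : θ * 256 / (K * D ^ (p - 1)) ≤ (ε ^ α * T) ^ (γ / 2) := by
    have := Real.rpow_le_rpow hc₂pos.le h2 (show 0 ≤ γ / 2 by positivity)
    rwa [hc₂, ← Real.rpow_mul (by positivity), show 2 / γ * (γ / 2) = 1 by field_simp, Real.rpow_one] at this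
  have h4 : (ε ^ α * T) ^ (γ / 2) = ε ^ (p * (p - 1)) * T ^ (γ / 2) := by
    rw [Real.mul_rpow (by positivity) hTpos.le, ← Real.rpow_mul hε.le]
    congr 2
    rw [hα]; field_simp
  have h5 : K * (T / 4 * (ε * (c₀ * ((2 * T) ^ m)⁻¹)) ^ p * d) = D * (ε ^ p * T ^ (1 - m * p)) := by
    rw [hD, show ε * (c₀ * ((2 * T) ^ m)⁻¹) = ε * (c₀ * (2 ^ m)⁻¹) * (T ^ m)⁻¹ by rw [mul_pow, mul_inv]; ring,
      Real.mul_rpow (by positivity) (by positivity), Real.mul_rpow (by positivity) (by positivity),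
      Real.inv_rpow (by positivity), ← Real.rpow_natCast T m, ← Real.rpow_mul hTpos.le,
      ← Real.rpow_neg hTpos.le, sub_eq_add_neg, Real.rpow_add hTpos, Real.rpow_one]
    ring
  have h6 : (D * (ε ^ p * T ^ (1 - m * p))) ^ (p - 1) * T ^ 2 = D ^ (p - 1) * (ε ^ (p * (p - 1)) * T ^ (γ / 2)) := by
    rw [Real.mul_rpow hDpos.le (by positivity), Real.mul_rpow (x := ε ^ p) (by positivity) (by positivity),
      ← Real.rpow_mul hε.le, ← Real.rpow_mul hTpos.le, hγ2, Real.rpow_add hTpos, Real.rpow_two]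
    ring
  rw [h5]
  rw [h4, div_le_iff₀ (by positivity)] at h3
  have : K * (T / 4) ^ 2 / 16 * (D * (ε ^ p * T ^ (1 - m * p))) ^ (p - 1) =
      K / 256 * ((D * (ε ^ p * T ^ (1 - m * p))) ^ (p - 1) * T ^ 2) := by ring
  rw [this, h6]
  linarith


/-- **Upper bound of the lifespan, subcritical case, odd dimensions** (Proposition 8.1):
for odd `n ≥ 5` and `1 < p < p₀(n)`, under the blow-up assumptions on the data, there are
`ε₀ > 0` and `c > 0`, independent of `ε`, such that for `0 < ε ≤ ε₀` no `C⁰`-solution of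
`u = ε u⁰ + L(|u|^p)` on `ℝⁿ × [0,T]` exists with `T > c ε^{−2p(p−1)/γ(p,n)}`. -/
theorem lifespan_upper_subcritical_odd (n m : ℕ) (hnm : n = 2 * m + 1) (hn : 5 ≤ n)
    (p : ℝ) (hp1 : 1 < p) (hp2 : p < pCrit n) (k k₀ k₁ : ℝ)
    (hk₀ : 0 < k₀) (h₀₁ : k₀ < k₁) (h₁k : k₁ < k)
    (g : ℝ → ℝ) (hg : ContDiff ℝ 1 g) (hgc : HasCompactSupport g)
    (hsupp : ∀ s : ℝ, k < s → g s = 0)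
    (hpos : ∀ s : ℝ, k₀ < s → s < k → 0 ≤ g s)
    (hint : 0 < ∫ lam in ((k₁ + k) / 2)..k, lam ^ (n / 2) * g lam)
    (hLeg : ∀ z : ℝ, k₀ / k < z → 1 / 2 < legendreP m z) :
    ∃ ε₀ : ℝ, 0 < ε₀ ∧ ∃ c : ℝ, 0 < c ∧ ∀ ε : ℝ, 0 < ε → ε ≤ ε₀ →
      ∀ T : ℝ, 0 < T →
        (∃ u : Rn n → ℝ → ℝ,
          ContinuousOn (fun pr : Rn n × ℝ => u pr.1 pr.2) (Set.univ ×ˢ Set.Icc 0 T) ∧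
          ∀ x : Rn n, ∀ t ∈ Set.Icc (0:ℝ) T,
            u x t = ε * Rop n (fun y => g ‖y‖) x t +
              Lop n (fun y τ => |u y τ| ^ p) x t) →
        T ≤ c * ε ^ (-(2 * p * (p - 1) / gammaPN p n)) := by
  have hodd : n % 2 = 1 := by omega
  have hfact : Fact (1 ≤ n) := ⟨by omega⟩
  have hk : 0 < k := by linarith
  have hγ := gamma_pos n hn p hp1 hp2
  obtain ⟨c₀, hc₀, hR⟩ := Rop_lower n m hnm (by omega) k k₀ k₁ hk₀ h₀₁ h₁k g hg.continuous hsupp hpos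
    hint hLeg
  obtain ⟨c, hc, hcc⟩ := const_choice n m hnm p hp1 hγ (KL n) c₀ ((k - k₁) / 4)
    ((4:ℝ) ^ (1 / (p - 1))) k (KL_pos n (by omega)) hc₀ (by linarith) (by positivity) hk
  refine ⟨1, one_pos, c, hc, ?_⟩
  rintro ε hε hε1 T hT ⟨u, huc, hue⟩
  by_contra hcon
  obtain ⟨hT2, hbig⟩ := hcc ε hε hε1 T (not_le.1 hcon)
  -- extend `u` continuously in time
  set v : Rn n → ℝ → ℝ := fun x t => u x (Set.projIcc 0 T hT.le t) with hv
  have hvu : ∀ x, ∀ t ∈ Set.Icc (0:ℝ) T, v x t = u x t := by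
    intro x t ht
    simp only [hv, Set.projIcc_of_mem hT.le ht]
  have hvc : Continuous (fun q : Rn n × ℝ => v q.1 q.2) := by
    have hm : Continuous (fun q : Rn n × ℝ => (q.1, ((Set.projIcc 0 T hT.le q.2 : Set.Icc (0:ℝ) T) : ℝ))) := by
      have := continuous_projIcc (h := hT.le)
      fun_prop
    exact huc.comp_continuous hm (fun q => ⟨Set.mem_univ _, (Set.projIcc 0 T hT.le q.2).2⟩)
  have hve : ∀ x, ∀ t ∈ Set.Icc (0:ℝ) T, v x t = ε * Rop n (fun y => g ‖y‖) x t +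
      Lop n (fun y τ => |v y τ| ^ p) x t := by
    intro x t ht
    rw [hvu x t ht, hue x t ht]
    congr 1
    unfold Lop
    congr 1
    apply intervalIntegral.integral_congr
    intro τ hτ
    rw [Set.uIcc_of_le ht.1] at hτ
    simp only [fun y => hvu y τ ⟨hτ.1, hτ.2.trans ht.2⟩]
  have hR0 : ∀ (x : Rn n) (t : ℝ), k < t - ‖x‖ → Rop n (fun y => g ‖y‖) x t = 0 :=
    fun x t h => Rop_huygens n hodd g k hsupp hk x t h
  have hKpos := KL_pos n (by omega)
  have hd : 0 < (k - k₁) / 4 := by linarith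
  refine blowup hodd hn hp1 hvc T _ hT ?_ ?_
    (first_step hnm hn hp1 hvc T ε k k₁ c₀ hε hc₀ (by linarith) h₁k hT2 _ hR0 hR hve) hbig
  · positivity
  · intro x t htT hxt
    have := norm_nonneg x
    rw [hve x t ⟨by linarith, htT⟩, hR0 x t (by linarith), mul_zero, zero_add]
end
end
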